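/- For every δ ∈ (0,1) there is a constant C = C(M, δ) > 0 such that: for every spherically symmetric solution φ of the wave equation on the exterior of the Schwarzschild spacetime of mass M with E₁(φ) < ∞, setting ψ := Sφ = t ∂_tφ + s ∂_sφ, for all t* ≥ 2 one has ∫_{−t*/2}^{t*/2} [ (∂_tψ)² + (∂_sψ)² ](t*, s) · r(s)² ds ≤ C t*^{−2+δ} E₁(φ). -/

import Mathlib

open Real MeasureTheory

noncomputable section

/-- partial derivative in the first (time) variable -/
def pd_t (φ : ℝ → ℝ → ℝ) : ℝ → ℝ → ℝ := fun t s => deriv (fun t' => φ t' s) t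

/-- partial derivative in the second (tortoise) variable -/
def pd_s (φ : ℝ → ℝ → ℝ) : ℝ → ℝ → ℝ := fun t s => deriv (fun s' => φ t s') s

/-- the scaling vector field `S ξ = t ∂_t ξ + s ∂_s ξ` -/
def Svf (φ : ℝ → ℝ → ℝ) : ℝ → ℝ → ℝ := fun t s => t * pd_t φ t s + s * pd_s φ t s

/-- `r` is the Schwarzschild area-radius of mass `M` in the Regge-Wheeler tortoise
coordinate: `r(s) > 2M`, `r' = 1 - 2M/r`, `r(0) = 3M`. -/
def IsTortoise (M : ℝ) (r : ℝ → ℝ) : Prop :=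
  (∀ s, 2 * M < r s) ∧ (∀ s, HasDerivAt r (1 - 2 * M / r s) s) ∧ r 0 = 3 * M

/-- `μ(s) = 2M / r(s)` -/
def muS (M : ℝ) (r : ℝ → ℝ) (s : ℝ) : ℝ := 2 * M / r s

/-- a spherically symmetric solution of the wave equation on the exterior of the
Schwarzschild spacetime: smooth, satisfying `∂_t²φ = r⁻² ∂_s(r² ∂_s φ)`, and supported
away from spatial infinity. -/
def IsWaveSol (r : ℝ → ℝ) (φ : ℝ → ℝ → ℝ) : Prop :=
  ContDiff ℝ (⊤ : ℕ∞) (Function.uncurry φ) ∧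
  (∀ t s, pd_t (pd_t φ) t s = ((r s) ^ 2)⁻¹ * deriv (fun x => (r x) ^ 2 * pd_s φ t x) s) ∧
  ∃ S₀ : ℝ, ∀ t s, S₀ + |t - 1| ≤ s → φ t s = 0

/-- the integrand of the initial energy `E₀(ξ)`, evaluated on the slice `t = 1`. -/
def E0Integrand (M : ℝ) (r : ℝ → ℝ) (ξ : ℝ → ℝ → ℝ) (s : ℝ) : ℝ :=
  ((1 - muS M r s)⁻¹ * (pd_t ξ 1 s - pd_s ξ 1 s) ^ 2
    + (pd_t ξ 1 s + pd_s ξ 1 s) ^ 2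
    + ((1 - s) / 2) ^ 2 * (pd_t ξ 1 s - pd_s ξ 1 s) ^ 2
    + ((1 + s) / 2) ^ 2 * (pd_t ξ 1 s + pd_s ξ 1 s) ^ 2
    + (1 - muS M r s) * ((1 + s ^ 2) / (r s) ^ 2) * (ξ 1 s) ^ 2) * (r s) ^ 2

/-- the initial energy `E₀(ξ)` -/
def E0 (M : ℝ) (r : ℝ → ℝ) (ξ : ℝ → ℝ → ℝ) : ℝ := ∫ s, E0Integrand M r ξ s

/-- `E₀(ξ) < ∞` : the (nonnegative) integrand of `E₀(ξ)` is integrable -/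
def FinE0 (M : ℝ) (r : ℝ → ℝ) (ξ : ℝ → ℝ → ℝ) : Prop := Integrable (E0Integrand M r ξ)

/-- `E₁(ξ) = E₀(Sξ) + E₀(ξ) + E₀(∂_t ξ)` -/
def E1 (M : ℝ) (r : ℝ → ℝ) (ξ : ℝ → ℝ → ℝ) : ℝ :=
  E0 M r (Svf ξ) + E0 M r ξ + E0 M r (pd_t ξ)

/-- `E₁(ξ) < ∞` -/
def FinE1 (M : ℝ) (r : ℝ → ℝ) (ξ : ℝ → ℝ → ℝ) : Prop :=
  FinE0 M r (Svf ξ) ∧ FinE0 M r ξ ∧ FinE0 M r (pd_t ξ)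

section
def eKd (τ s V v vt vs : ℝ) : ℝ :=
  ((τ + s) ^ 2 * (vt + vs) ^ 2 + (τ - s) ^ 2 * (vt - vs) ^ 2) / 4 + (τ ^ 2 + s ^ 2) / 2 * V * v ^ 2

def jKd (τ s V v vt vs : ℝ) : ℝ :=
  (τ ^ 2 + s ^ 2) * vt * vs + τ * s * (vt ^ 2 + vs ^ 2 - V * v ^ 2)

def m0d (f h v vt vs : ℝ) : ℝ := vt * (f * vs + h * v)

def j0d (f h k V v vt vs : ℝ) : ℝ :=
  f / 2 * (vt ^ 2 + vs ^ 2 - V * v ^ 2) + h * v * vs + k * v ^ 2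

def Kd (τ s vt vs : ℝ) : ℝ := (τ ^ 2 + s ^ 2) * vt + 2 * τ * s * vs

/-- the remainder `∂_t N - ∂_s J` for one field (without the factor `τ^{-δ}`) -/
def Rd (δ c τ s V W f h k X Xt Xs Q F v vt vs : ℝ) : ℝ :=
  -δ / τ * (eKd τ s V v vt vs + c * τ ^ 2 * X * m0d f h v vt vs) + τ * W * v ^ 2
    + Kd τ s vt vs * F + 2 * c * τ * X * m0d f h v vt vs
    + c * τ ^ 2 * (Xt * m0d f h v vt vs - Xs * j0d f h k V v vt vs
      + X * F * (f * vs + h * v) - X * Q)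

lemma amgm {A B C x : ℝ} (hA : 0 ≤ A) (hB : 0 ≤ B) (h : x ^ 2 ≤ C * A * B) (hC : C = 4) :
    |x| ≤ A + B := by
  apply abs_le_of_sq_le_sq _ (by positivity)
  subst hC
  nlinarith [sq_nonneg (A - B)]

lemma eKd_nonneg {τ s V v vt vs : ℝ} (hV : 0 ≤ V) : 0 ≤ eKd τ s V v vt vs := by
  unfold eKd; positivity

lemma eKd_ge_V {τ s V v vt vs : ℝ} (_hV : 0 ≤ V) : τ ^ 2 / 2 * (V * v ^ 2) ≤ eKd τ s V v vt vs := by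
  unfold eKd
  have : 0 ≤ ((τ + s) ^ 2 * (vt + vs) ^ 2 + (τ - s) ^ 2 * (vt - vs) ^ 2) / 4 := by positivity
  have : 0 ≤ s ^ 2 / 2 * V * v ^ 2 := by positivity
  nlinarith

lemma eKd_ge {τ s V v vt vs : ℝ} (hV : 0 ≤ V) (hτ : 0 < τ) (hs : |s| ≤ τ / 2) :
    τ ^ 2 / 8 * (vt ^ 2 + vs ^ 2 + V * v ^ 2) ≤ eKd τ s V v vt vs := by
  unfold eKd
  obtain ⟨h1, h2⟩ := abs_le.1 hs
  have a1 : τ ^ 2 / 4 ≤ (τ + s) ^ 2 := by nlinarith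
  have a2 : τ ^ 2 / 4 ≤ (τ - s) ^ 2 := by nlinarith
  have b1 := mul_le_mul_of_nonneg_right a1 (sq_nonneg (vt + vs))
  have b2 := mul_le_mul_of_nonneg_right a2 (sq_nonneg (vt - vs))
  have b3 : 0 ≤ (τ ^ 2 * 3 / 8 + s ^ 2 / 2) * (V * v ^ 2) := by positivity
  nlinarith

lemma Kd_sq {τ s V v vt vs : ℝ} (hV : 0 ≤ V) (hτ : 0 < τ) :
    (Kd τ s vt vs) ^ 2 ≤ 2 * (τ + |s|) ^ 2 * eKd τ s V v vt vs := by
  have e : Kd τ s vt vs = ((τ + s) ^ 2 * (vt + vs) + (τ - s) ^ 2 * (vt - vs)) / 2 := by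
    unfold Kd; ring
  have a1 : (τ + s) ^ 2 ≤ (τ + |s|) ^ 2 := by
    apply sq_le_sq.2; rw [abs_of_nonneg (by positivity : 0 ≤ τ + |s|)]
    calc _ ≤ |τ| + |s| := abs_add_le _ _
      _ = _ := by rw [abs_of_pos hτ]
  have a2 : (τ - s) ^ 2 ≤ (τ + |s|) ^ 2 := by
    apply sq_le_sq.2; rw [abs_of_nonneg (by positivity : 0 ≤ τ + |s|)]
    calc _ ≤ |τ| + |s| := abs_sub _ _
      _ = _ := by rw [abs_of_pos hτ]
  have b1 := mul_le_mul_of_nonneg_right a1 (by positivity : 0 ≤ (τ + s) ^ 2 * (vt + vs) ^ 2)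
  have b2 := mul_le_mul_of_nonneg_right a2 (by positivity : 0 ≤ (τ - s) ^ 2 * (vt - vs) ^ 2)
  have b3 : 0 ≤ 2 * (τ + |s|) ^ 2 * ((τ ^ 2 + s ^ 2) / 2 * V * v ^ 2) := by positivity
  rw [e]; unfold eKd
  nlinarith [sq_nonneg ((τ + s) ^ 2 * (vt + vs) - (τ - s) ^ 2 * (vt - vs))]

lemma m0_bound {C τ s V f h v vt vs : ℝ} (hC : 1 ≤ C) (hV : 0 ≤ V) (hτ : 0 < τ)
    (hs : |s| ≤ τ / 2) (hf : |f| ≤ C) (hh : h ^ 2 ≤ C * V) :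
    τ ^ 2 * |m0d f h v vt vs| ≤ 8 * C * eKd τ s V v vt vs := by
  have e := eKd_ge (v := v) (vt := vt) (vs := vs) hV hτ hs
  have : |m0d f h v vt vs| ≤ C * (vt ^ 2 + vs ^ 2 + V * v ^ 2) := by
    unfold m0d
    have x1 : |vt * vs| ≤ (vt ^ 2 + vs ^ 2) / 2 := by
      rw [abs_le]; constructor <;> nlinarith [sq_nonneg (vt + vs), sq_nonneg (vt - vs)]
    have x2 : |vt * (h * v)| ≤ (vt ^ 2 + C * V * v ^ 2) / 2 := by
      have := mul_le_mul_of_nonneg_right hh (sq_nonneg v)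
      rw [abs_le]; constructor <;> nlinarith [sq_nonneg (vt + h * v), sq_nonneg (vt - h * v)]
    have x3 : |f * (vt * vs)| ≤ C * ((vt ^ 2 + vs ^ 2) / 2) := by
      rw [abs_mul]; gcongr
    calc |vt * (f * vs + h * v)| = |f * (vt * vs) + vt * (h * v)| := by congr 1; ring
      _ ≤ _ := abs_add_le _ _
      _ ≤ C * ((vt ^ 2 + vs ^ 2) / 2) + (vt ^ 2 + C * V * v ^ 2) / 2 := add_le_add x3 x2
      _ ≤ _ := by nlinarith [mul_nonneg (sub_nonneg.2 hC) (sq_nonneg vt), mul_nonneg (sub_nonneg.2 hC) (sq_nonneg vs), mul_nonneg hV (sq_nonneg v), sq_nonneg vs, mul_nonneg (by linarith : 0 ≤ C) (mul_nonneg hV (sq_nonneg v))]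
  calc _ ≤ τ ^ 2 * (C * (vt ^ 2 + vs ^ 2 + V * v ^ 2)) := by gcongr
    _ = 8 * C * (τ ^ 2 / 8 * (vt ^ 2 + vs ^ 2 + V * v ^ 2)) := by ring
    _ ≤ _ := by gcongr

lemma j0_bound {C τ s V f h k v vt vs : ℝ} (hC : 1 ≤ C) (hV : 0 ≤ V) (hτ : 0 < τ)
    (hs : |s| ≤ τ / 2) (hf : |f| ≤ C) (hh : h ^ 2 ≤ C * V) (hk : |k| ≤ C * V) :
    τ ^ 2 * |j0d f h k V v vt vs| ≤ 16 * C * eKd τ s V v vt vs := by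
  have e := eKd_ge (v := v) (vt := vt) (vs := vs) hV hτ hs
  have hVv : 0 ≤ V * v ^ 2 := by positivity
  have : |j0d f h k V v vt vs| ≤ 2 * C * (vt ^ 2 + vs ^ 2 + V * v ^ 2) := by
    unfold j0d
    have x1 : |(vt ^ 2 + vs ^ 2 - V * v ^ 2) / 2| ≤ (vt ^ 2 + vs ^ 2 + V * v ^ 2) / 2 := by
      rw [abs_le]; constructor <;> nlinarith [sq_nonneg vt, sq_nonneg vs]
    have x2 : |h * v * vs| ≤ (vs ^ 2 + C * V * v ^ 2) / 2 := by
      have := mul_le_mul_of_nonneg_right hh (sq_nonneg v)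
      rw [abs_le]; constructor <;> nlinarith [sq_nonneg (vs + h * v), sq_nonneg (vs - h * v)]
    have x3 : |f * ((vt ^ 2 + vs ^ 2 - V * v ^ 2) / 2)| ≤ C * ((vt ^ 2 + vs ^ 2 + V * v ^ 2) / 2) := by
      rw [abs_mul]; gcongr
    have x4 : |k * v ^ 2| ≤ C * V * v ^ 2 := by
      rw [abs_mul, abs_of_nonneg (sq_nonneg v)]; gcongr
    calc _ = |f * ((vt ^ 2 + vs ^ 2 - V * v ^ 2) / 2) + h * v * vs + k * v ^ 2| := by congr 1; ring
      _ ≤ _ := abs_add_three _ _ _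
      _ ≤ C * ((vt ^ 2 + vs ^ 2 + V * v ^ 2) / 2) + (vs ^ 2 + C * V * v ^ 2) / 2 + C * V * v ^ 2 :=
          add_le_add (add_le_add x3 x2) x4
      _ ≤ _ := by nlinarith [mul_nonneg (sub_nonneg.2 hC) (sq_nonneg vt), mul_nonneg (sub_nonneg.2 hC) (sq_nonneg vs), sq_nonneg vs, sq_nonneg vt, mul_nonneg (by linarith : 0 ≤ C) hVv]
  calc _ ≤ τ ^ 2 * (2 * C * (vt ^ 2 + vs ^ 2 + V * v ^ 2)) := by gcongr
    _ = 16 * C * (τ ^ 2 / 8 * (vt ^ 2 + vs ^ 2 + V * v ^ 2)) := by ring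
    _ ≤ _ := by gcongr

/-- coefficient hypotheses at a point -/
structure Coef (C R τ s V W f h k X Xt Xs p q : ℝ) : Prop where
  hC : 1 ≤ C
  hV : 0 ≤ V
  hτ : 0 < τ
  hp : 0 ≤ p
  hq : 0 ≤ q
  hf : |f| ≤ C
  hh : h ^ 2 ≤ C * V
  hk : |k| ≤ C * V
  hpq : W ^ 2 ≤ C * p * q
  hWh : (W * h) ^ 2 ≤ C * q ^ 2
  hWq : |s| ≤ R → W ≤ C * q
  hWR : R ≤ |s| → W ≤ 0
  hsW : s ^ 2 * W ^ 2 ≤ C * V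
  hX0 : 0 ≤ X
  hX1 : X ≤ 1
  hXin : |s| ≤ τ / 4 → X = 1
  hXout : τ / 2 < |s| → X = 0 ∧ Xt = 0 ∧ Xs = 0
  hXt : τ * |Xt| ≤ C
  hXs : τ * |Xs| ≤ C

variable {C R τ s V W f h k X Xt Xs p q : ℝ}

lemma N_cmp (H : Coef C R τ s V W f h k X Xt Xs p q) {δ c : ℝ} (hδ : 0 < δ) (hδ1 : δ < 1)
    (hc : c * (160 * C ^ 2) = δ) (v vt vs : ℝ) :
    |c * τ ^ 2 * X * m0d f h v vt vs| ≤ eKd τ s V v vt vs / 2 := by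
  have hC := H.hC
  have hτ := H.hτ
  have he := eKd_nonneg (τ := τ) (s := s) (v := v) (vt := vt) (vs := vs) H.hV
  have hc0 : 0 < c := by
    by_contra hcon
    have : c * (160 * C ^ 2) ≤ 0 := mul_nonpos_of_nonpos_of_nonneg (not_lt.1 hcon) (by positivity)
    linarith
  by_cases hs : |s| ≤ τ / 2
  · have b := m0_bound (v := v) (vt := vt) (vs := vs) hC H.hV hτ hs H.hf H.hh
    calc _ = X * (c * (τ ^ 2 * |m0d f h v vt vs|)) := by
            rw [abs_mul, abs_of_nonneg (by have := H.hX0; positivity : 0 ≤ c * τ ^ 2 * X)]; ring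
      _ ≤ 1 * (c * (8 * C * eKd τ s V v vt vs)) := by
            gcongr
            · exact H.hX1
      _ ≤ _ := by
        have : c * (8 * C) ≤ 1 / 2 := by nlinarith [mul_pos hc0 (by positivity : 0 < C)]
        nlinarith
  · obtain ⟨h1, -, -⟩ := H.hXout (not_le.1 hs)
    rw [h1]; simp; positivity

lemma R_field (H : Coef C R τ s V W f h k X Xt Xs p q) {δ c : ℝ} (hδ : 0 < δ) (hδ1 : δ < 1)
    (hc : c * (160 * C ^ 2) = δ) (hR : 4 * R ≤ τ) (hT : 2 * C ≤ c * τ) (v vt vs Q F : ℝ)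
    (hQ : p * (vt ^ 2 + vs ^ 2) + q * v ^ 2 ≤ Q) :
    Rd δ c τ s V W f h k X Xt Xs Q F v vt vs ≤
      -(3 * δ / 4) * (eKd τ s V v vt vs / τ)
       - c * τ ^ 2 * X * (p * (vt ^ 2 + vs ^ 2) + q * v ^ 2 / 2)
       + Kd τ s vt vs * F + c * τ ^ 2 * X * (F * (f * vs + h * v)) := by
  have hC := H.hC
  have hτ := H.hτ
  have hX0 := H.hX0
  have hq := H.hq
  have he := eKd_nonneg (τ := τ) (s := s) (v := v) (vt := vt) (vs := vs) H.hV
  have hc0 : 0 < c := by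
    by_contra hcon
    have : c * (160 * C ^ 2) ≤ 0 := mul_nonpos_of_nonpos_of_nonneg (not_lt.1 hcon) (by positivity)
    linarith
  -- claim 2
  have c2 : τ * W * v ^ 2 ≤ c * τ ^ 2 * X * (q * v ^ 2 / 2) := by
    by_cases hs : R ≤ |s|
    · have := H.hWR hs
      have h1 : τ * W * v ^ 2 ≤ 0 := by
        have : 0 ≤ τ * v ^ 2 := by positivity
        nlinarith
      have : 0 ≤ c * τ ^ 2 * X * (q * v ^ 2 / 2) := by positivity
      linarith
    · have hs' := (not_le.1 hs).le
      have hW := H.hWq hs'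
      rw [H.hXin (by linarith)]
      have h1 : τ * W * v ^ 2 ≤ τ * (C * q) * v ^ 2 := by gcongr
      have h2 : τ * q * v ^ 2 * (2 * C) ≤ τ * q * v ^ 2 * (c * τ) := by gcongr
      nlinarith
  -- claim 1
  have c1 : (2 - δ) * c * τ * X * m0d f h v vt vs
      + c * τ ^ 2 * (Xt * m0d f h v vt vs - Xs * j0d f h k V v vt vs)
      ≤ δ / 4 * (eKd τ s V v vt vs / τ) := by
    by_cases hs : |s| ≤ τ / 2
    · have bm := m0_bound (v := v) (vt := vt) (vs := vs) hC H.hV hτ hs H.hf H.hh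
      have bj := j0_bound (v := v) (vt := vt) (vs := vs) hC H.hV hτ hs H.hf H.hh H.hk
      set m := m0d f h v vt vs
      set j := j0d f h k V v vt vs
      set e := eKd τ s V v vt vs
      have t1 : (2 - δ) * X * (τ ^ 2 * m) ≤ 2 * (8 * C * e) := by
        calc _ ≤ (2 - δ) * X * (τ ^ 2 * |m|) := by
              gcongr
              · nlinarith
              · exact le_abs_self m
          _ ≤ 2 * 1 * (τ ^ 2 * |m|) := by
              gcongr
              · linarith
              · exact H.hX1
          _ ≤ _ := by linarith
      have t2 : (τ * Xt) * (τ ^ 2 * m) ≤ C * (8 * C * e) := by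
        calc _ ≤ |(τ * Xt) * (τ ^ 2 * m)| := le_abs_self _
          _ = (τ * |Xt|) * (τ ^ 2 * |m|) := by
            rw [abs_mul, abs_mul, abs_mul, abs_of_pos hτ, abs_of_nonneg (sq_nonneg τ)]
          _ ≤ _ := by gcongr; exact H.hXt
      have t3 : -((τ * Xs) * (τ ^ 2 * j)) ≤ C * (16 * C * e) := by
        calc _ ≤ |(τ * Xs) * (τ ^ 2 * j)| := neg_le_abs _
          _ = (τ * |Xs|) * (τ ^ 2 * |j|) := by
            rw [abs_mul, abs_mul, abs_mul, abs_of_pos hτ, abs_of_nonneg (sq_nonneg τ)]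
          _ ≤ _ := by gcongr; exact H.hXs
      have t4 : (2 - δ) * X * (τ ^ 2 * m) + (τ * Xt) * (τ ^ 2 * m) - ((τ * Xs) * (τ ^ 2 * j))
          ≤ 40 * C ^ 2 * e := by nlinarith [mul_nonneg (mul_nonneg (sub_nonneg.2 hC) (by linarith : 0 ≤ C)) he]
      have : (2 - δ) * c * τ * X * m + c * τ ^ 2 * (Xt * m - Xs * j) =
          c * ((2 - δ) * X * (τ ^ 2 * m) + (τ * Xt) * (τ ^ 2 * m) - ((τ * Xs) * (τ ^ 2 * j))) / τ := by
        field_simp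
        ring
      rw [this, ← mul_div_assoc]
      refine div_le_div_of_nonneg_right ?_ hτ.le
      calc _ ≤ c * (40 * C ^ 2 * e) := by gcongr
        _ = c * (160 * C ^ 2) * e / 4 := by ring
        _ = _ := by rw [hc]; ring
    · obtain ⟨h1, h2, h3⟩ := H.hXout (not_le.1 hs)
      rw [h1, h2, h3]
      have : 0 ≤ δ / 4 * (eKd τ s V v vt vs / τ) := by positivity
      simpa using this
  have c3 : c * τ ^ 2 * X * (p * (vt ^ 2 + vs ^ 2) + q * v ^ 2) ≤ c * τ ^ 2 * X * Q := by gcongr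
  have e1 : Rd δ c τ s V W f h k X Xt Xs Q F v vt vs =
     -δ * (eKd τ s V v vt vs / τ) + ((2 - δ) * c * τ * X * m0d f h v vt vs
      + c * τ ^ 2 * (Xt * m0d f h v vt vs - Xs * j0d f h k V v vt vs)) + τ * W * v ^ 2
      - c * τ ^ 2 * X * Q + Kd τ s vt vs * F + c * τ ^ 2 * X * (F * (f * vs + h * v)) := by
    unfold Rd; field_simp; ring
  rw [e1]
  linarith

lemma R_claim3 (H : Coef C R τ s V W f h k X Xt Xs p q) {δ c : ℝ} (hδ : 0 < δ) (hc0 : 0 < c)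
    (w wt ws u ut us : ℝ) :
    Kd τ s wt ws * (-(W * u)) ≤ δ / 4 * (eKd τ s V w wt ws / τ)
      + c / 4 * (τ ^ 2 * X * (p * (wt ^ 2 + ws ^ 2))) + 8 * C / c * (τ ^ 2 * X * (q * u ^ 2))
      + 100 * C / δ * (eKd τ s V u ut us / τ) := by
  have hC := H.hC
  have hτ := H.hτ
  have hX0 := H.hX0
  have hp := H.hp
  have hq := H.hq
  have hV := H.hV
  have hew := eKd_nonneg (τ := τ) (s := s) (v := w) (vt := wt) (vs := ws) hV
  have heu := eKd_nonneg (τ := τ) (s := s) (v := u) (vt := ut) (vs := us) hV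
  have hCu : eKd τ s V u ut us ≥ τ ^ 2 / 2 * (V * u ^ 2) := eKd_ge_V hV
  -- product bounds
  have pr : ∀ y : ℝ, (W * u * y) ^ 2 ≤ C * (p * y ^ 2) * (q * u ^ 2) := by
    intro y
    have := mul_le_mul_of_nonneg_right H.hpq (by positivity : 0 ≤ (u * y) ^ 2)
    calc _ = W ^ 2 * (u * y) ^ 2 := by ring
      _ ≤ _ := this
      _ = _ := by ring
  by_cases hs : |s| ≤ τ / 4
  · rw [H.hXin hs]
    have g : ∀ y : ℝ, 2 * |W * u * y| ≤ c / 4 * (p * y ^ 2) + 4 * C / c * (q * u ^ 2) := by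
      intro y
      have := amgm (A := c / 4 * (p * y ^ 2)) (B := 4 * C / c * (q * u ^ 2)) (C := 4) (x := 2 * (W * u * y))
        (by positivity) (by positivity) (by
          have := pr y
          calc _ = 4 * (W * u * y) ^ 2 := by ring
            _ ≤ 4 * (C * (p * y ^ 2) * (q * u ^ 2)) := by gcongr
            _ = _ := by field_simp) rfl
      rwa [abs_mul, abs_two] at this
    have k1 : Kd τ s wt ws * (-(W * u)) ≤ τ ^ 2 * (2 * |W * u * wt| + 2 * |W * u * ws|) := by
      have hs2 : s ^ 2 ≤ τ ^ 2 := by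
        apply sq_le_sq.2; rw [abs_of_pos hτ]; linarith
      have hs3 : |2 * τ * s| ≤ 2 * τ ^ 2 := by
        rw [abs_mul, abs_of_pos (by positivity : 0 < 2 * τ)]; nlinarith
      calc _ = -((τ ^ 2 + s ^ 2) * (W * u * wt)) - (2 * τ * s) * (W * u * ws) := by unfold Kd; ring
        _ ≤ |(τ ^ 2 + s ^ 2) * (W * u * wt)| + |(2 * τ * s) * (W * u * ws)| := by
          linarith [neg_le_abs ((τ ^ 2 + s ^ 2) * (W * u * wt)), neg_le_abs ((2 * τ * s) * (W * u * ws))]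
        _ = (τ ^ 2 + s ^ 2) * |W * u * wt| + |2 * τ * s| * |W * u * ws| := by
          rw [abs_mul (τ ^ 2 + s ^ 2), abs_mul (2 * τ * s) (W * u * ws), abs_of_nonneg (by positivity : 0 ≤ τ ^ 2 + s ^ 2)]
        _ ≤ (τ ^ 2 + τ ^ 2) * |W * u * wt| + 2 * τ ^ 2 * |W * u * ws| := by gcongr
        _ = _ := by ring
    have k2 : τ ^ 2 * (2 * |W * u * wt| + 2 * |W * u * ws|) ≤ τ ^ 2 * (c / 4 * (p * wt ^ 2) + 4 * C / c * (q * u ^ 2) + (c / 4 * (p * ws ^ 2) + 4 * C / c * (q * u ^ 2))) := by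
      have := g wt
      have := g ws
      gcongr
    have k3 : 0 ≤ δ / 4 * (eKd τ s V w wt ws / τ) + 100 * C / δ * (eKd τ s V u ut us / τ) := by positivity
    calc _ ≤ _ := k1.trans k2
      _ = c / 4 * (τ ^ 2 * 1 * (p * (wt ^ 2 + ws ^ 2))) + 8 * C / c * (τ ^ 2 * 1 * (q * u ^ 2)) := by ring
      _ ≤ _ := by linarith
  · have hs' := not_le.1 hs
    have kk := Kd_sq (s := s) (v := w) (vt := wt) (vs := ws) hV hτ
    generalize eKd τ s V w wt ws = ew at *
    generalize eKd τ s V u ut us = eu at *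
    have s1 : (τ + |s|) ^ 2 ≤ 25 * s ^ 2 := by
      rw [← sq_abs s]; nlinarith [abs_nonneg s]
    have s2 : (Kd τ s wt ws * (-(W * u))) ^ 2 ≤ 100 * C * (ew / τ) * (eu / τ) := by
      calc _ = (Kd τ s wt ws) ^ 2 * (W ^ 2 * u ^ 2) := by ring
        _ ≤ (2 * (25 * s ^ 2) * ew) * (W ^ 2 * u ^ 2) := by
          gcongr; exact kk.trans (by gcongr)
        _ = 50 * ew * (s ^ 2 * W ^ 2 * u ^ 2) := by ring
        _ ≤ 50 * ew * (C * V * u ^ 2) := mul_le_mul_of_nonneg_left (mul_le_mul_of_nonneg_right H.hsW (sq_nonneg u)) (by positivity)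
        _ = 100 * C * ew / τ ^ 2 * (τ ^ 2 / 2 * (V * u ^ 2)) := by field_simp; ring
        _ ≤ 100 * C * ew / τ ^ 2 * eu := by gcongr
        _ = _ := by field_simp
    have := amgm (A := δ / 4 * (ew / τ)) (B := 100 * C / δ * (eu / τ)) (C := 4)
      (x := Kd τ s wt ws * (-(W * u))) (by positivity) (by positivity) (by
        refine s2.trans (le_of_eq ?_); field_simp) rfl
    have k3 : 0 ≤ c / 4 * (τ ^ 2 * X * (p * (wt ^ 2 + ws ^ 2))) + 8 * C / c * (τ ^ 2 * X * (q * u ^ 2)) := by positivity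
    linarith [le_abs_self (Kd τ s wt ws * (-(W * u)))]

lemma R_claim4 (H : Coef C R τ s V W f h k X Xt Xs p q) (w ws u : ℝ) :
    (-(W * u)) * (f * ws + h * w) ≤ p * ws ^ 2 / 4 + q * w ^ 2 / 4 + (C ^ 3 + C) * (q * u ^ 2) := by
  have hC := H.hC
  have hp := H.hp
  have hq := H.hq
  -- product bounds
  have pr : ∀ y : ℝ, (W * u * y) ^ 2 ≤ C * (p * y ^ 2) * (q * u ^ 2) := by
    intro y
    have := mul_le_mul_of_nonneg_right H.hpq (by positivity : 0 ≤ (u * y) ^ 2)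
    calc _ = W ^ 2 * (u * y) ^ 2 := by ring
      _ ≤ _ := this
      _ = _ := by ring
  have g1 : |f * (W * u * ws)| ≤ p * ws ^ 2 / 4 + C ^ 3 * (q * u ^ 2) := by
    apply amgm (C := 4) (by positivity) (by positivity) _ rfl
    have hf2 : f ^ 2 ≤ C ^ 2 := by rw [← sq_abs f]; have := H.hf; gcongr
    calc _ = f ^ 2 * (W * u * ws) ^ 2 := by ring
      _ ≤ C ^ 2 * (C * (p * ws ^ 2) * (q * u ^ 2)) := by have := pr ws; gcongr
      _ = _ := by ring
  have g2 : |W * u * (h * w)| ≤ q * w ^ 2 / 4 + C * (q * u ^ 2) := by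
    apply amgm (C := 4) (by positivity) (by positivity) _ rfl
    have := mul_le_mul_of_nonneg_right H.hWh (by positivity : 0 ≤ (u * w) ^ 2)
    calc _ = (W * h) ^ 2 * (u * w) ^ 2 := by ring
      _ ≤ _ := this
      _ = _ := by ring
  have := neg_le_abs (f * (W * u * ws))
  have := neg_le_abs (W * u * (h * w))
  nlinarith

lemma R_total (H : Coef C R τ s V W f h k X Xt Xs p q) {δ c D B : ℝ} (hδ : 0 < δ) (hδ1 : δ < 1)
    (hc : c * (160 * C ^ 2) = δ) (hD : D = 8 * C / c + 100 * C / δ + c * (C ^ 3 + C))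
    (hB : B = 2 * D / c + 2 * D / δ)
    (hR : 4 * R ≤ τ) (hT : 2 * C ≤ c * τ) (w wt ws Qw u ut us Qu : ℝ)
    (hQw : p * (wt ^ 2 + ws ^ 2) + q * w ^ 2 ≤ Qw)
    (hQu : p * (ut ^ 2 + us ^ 2) + q * u ^ 2 ≤ Qu) :
    Rd δ c τ s V W f h k X Xt Xs Qw (-(W * u)) w wt ws
      + B * Rd δ c τ s V W f h k X Xt Xs Qu 0 u ut us ≤ 0 := by
  have hC := H.hC
  have hτ := H.hτ
  have hX0 := H.hX0
  have hp := H.hp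
  have hq := H.hq
  have hV := H.hV
  have hc0 : 0 < c := by
    by_contra hcon
    have : c * (160 * C ^ 2) ≤ 0 := mul_nonpos_of_nonpos_of_nonneg (not_lt.1 hcon) (by positivity)
    linarith
  have r1 := R_field H hδ hδ1 hc hR hT w wt ws Qw (-(W * u)) hQw
  have r2 := R_field H hδ hδ1 hc hR hT u ut us Qu 0 hQu
  have hew := eKd_nonneg (τ := τ) (s := s) (v := w) (vt := wt) (vs := ws) hV
  have heu := eKd_nonneg (τ := τ) (s := s) (v := u) (vt := ut) (vs := us) hV
  have hD0 : 0 < D := by rw [hD]; positivity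
  have hCu : eKd τ s V u ut us ≥ τ ^ 2 / 2 * (V * u ^ 2) := eKd_ge_V hV
  have c3 := R_claim3 H hδ hc0 w wt ws u ut us
  have c4 := R_claim4 H w ws u
  have c4' : c * τ ^ 2 * X * (-(W * u) * (f * ws + h * w)) ≤ c * τ ^ 2 * X * (p * ws ^ 2 / 4 + q * w ^ 2 / 4 + (C ^ 3 + C) * (q * u ^ 2)) := by gcongr
  generalize Rd δ c τ s V W f h k X Xt Xs Qw (-(W * u)) w wt ws = Rw at *
  generalize Rd δ c τ s V W f h k X Xt Xs Qu 0 u ut us = Ru at *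
  generalize eKd τ s V w wt ws = ew at *
  generalize eKd τ s V u ut us = eu at *
  generalize Kd τ s wt ws * (-(W * u)) = KW at *
  have hw : Rw ≤
      D * (τ ^ 2 * X * (q * u ^ 2)) + D * (eu / τ) := by
    have d1 : 8 * C / c + c * (C ^ 3 + C) ≤ D := by rw [hD]; have : 0 ≤ 100 * C / δ := by positivity
                                                    linarith
    have d2 : 100 * C / δ ≤ D := by
      rw [hD]; have : 0 ≤ 8 * C / c + c * (C ^ 3 + C) := by positivity
      linarith
    have f1 := mul_le_mul_of_nonneg_right d1 (by positivity : 0 ≤ τ ^ 2 * X * (q * u ^ 2))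
    have f2 := mul_le_mul_of_nonneg_right d2 (by positivity : 0 ≤ eu / τ)
    have f3 : 0 ≤ c * τ ^ 2 * X * (p * wt ^ 2) := by positivity
    have f4 : 0 ≤ c * τ ^ 2 * X * (p * ws ^ 2) := by positivity
    have f5 : 0 ≤ c * τ ^ 2 * X * (q * w ^ 2) := by positivity
    have f6 : 0 ≤ δ * (ew / τ) := by positivity
    clear hQw hQu hD hB r2 c4
    generalize ew / τ = ew' at *
    generalize eu / τ = eu' at *
    linarith
  have hu : Ru ≤
      -(3 * δ / 4) * (eu / τ) - c / 2 * (τ ^ 2 * X * (q * u ^ 2)) := by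
    have f3 : 0 ≤ c * τ ^ 2 * X * (p * (ut ^ 2 + us ^ 2)) := by positivity
    linarith
  have hB0 : 0 < B := by rw [hB]; positivity
  have b1 : D ≤ B * (c / 2) := by
    have : B * (c / 2) = D + D * c / δ := by rw [hB]; field_simp
    have : 0 ≤ D * c / δ := by positivity
    linarith
  have b2 : D ≤ B * (3 * δ / 4) := by
    have : B * (3 * δ / 4) = 3 / 2 * D + 3 / 2 * (D * δ / c) := by rw [hB]; field_simp; ring
    have : 0 ≤ D * δ / c := by positivity
    linarith
  have f1 := mul_le_mul_of_nonneg_right b1 (by positivity : 0 ≤ τ ^ 2 * X * (q * u ^ 2))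
  have f2 := mul_le_mul_of_nonneg_right b2 (by positivity : 0 ≤ eu / τ)
  have f3 := mul_le_mul_of_nonneg_left hu hB0.le
  linarith
end

section
lemma disc_nonneg {x : ℝ} (h0 : 0 ≤ x) (h1 : x ≤ 1) :
    ((-(1/2) * (1 - x^2) ^ 2 * x - (5 - x) * (1 - x^2) * (3 - 4 * (1 - x^2)) +
      2 * (1/4 - (1 - x^2) / 2 - 3/2 * (1 - x^2) ^ 2))) ^ 2 ≤
    4 * (2 * (5 - x) * (1 - x^2) + 1/10) *
     (1/2 * (1 - (1 - x^2) / 4 - (5 - x) * (1 - x^2) ^ 2) * (3 - 4 * (1 - x^2))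
       - 1/8 * (1 - x^2) * x ^ 2 - 1/4 * (1 - x^2) ^ 3 * x
       - (3 - 4 * (1 - x^2)) * (1/4 - (1 - x^2) / 2 - 3/2 * (1 - x^2) ^ 2)
       - (1 - x^2) * x ^ 2 * (-1/2 - 3 * (1 - x^2)) - 1/20) := by
  have h2 : 0 ≤ 1 - x := by linarith
  have key : 0 ≤ (272 / 25) * (x ^ 0 * (1 - x) ^ 15)
      + (674 / 5) * (x ^ 1 * (1 - x) ^ 14)
      + (15993 / 20) * (x ^ 2 * (1 - x) ^ 13)
      + (63783 / 20) * (x ^ 3 * (1 - x) ^ 12)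
      + (195111 / 20) * (x ^ 4 * (1 - x) ^ 11)
      + (2317629 / 100) * (x ^ 5 * (1 - x) ^ 10)
      + (205176 / 5) * (x ^ 6 * (1 - x) ^ 9)
      + (517301 / 10) * (x ^ 7 * (1 - x) ^ 8)
      + (443701 / 10) * (x ^ 8 * (1 - x) ^ 7)
      + (242777 / 10) * (x ^ 9 * (1 - x) ^ 6)
      + (188936 / 25) * (x ^ 10 * (1 - x) ^ 5)
      + (12509 / 10) * (x ^ 11 * (1 - x) ^ 4)
      + (9549 / 20) * (x ^ 12 * (1 - x) ^ 3)
      + (6379 / 20) * (x ^ 13 * (1 - x) ^ 2)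
      + (1433 / 20) * (x ^ 14 * (1 - x) ^ 1)
      + (3 / 100) * (x ^ 15 * (1 - x) ^ 0) := by positivity
  refine sub_nonneg.1 (key.trans (le_of_eq ?_))
  ring

/-- the coefficient functions, as functions of `a = 1/(2M)`, `m = μ`, `σ = √(1-μ)` -/
def fC (m σ : ℝ) : ℝ := 1 - m / 4 - (5 - σ) * m ^ 2
def hC (a m σ : ℝ) : ℝ := a * (5 - σ) * m ^ 3 * σ ^ 2
def kC (a m σ : ℝ) : ℝ := a ^ 2 * m ^ 3 * σ ^ 2 * (1 / 4 - m / 2 - 3 / 2 * m ^ 2)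
def VC (a m σ : ℝ) : ℝ := a ^ 2 * m ^ 3 * σ ^ 2
/-- their derivatives -/
def fCD (a m σ : ℝ) : ℝ := a * m ^ 2 * σ * (σ / 4 + m ^ 2 / 2 + 2 * (5 - σ) * m * σ)
def hCD (a m σ : ℝ) : ℝ := a ^ 2 * m ^ 3 * σ ^ 2 * (-(1 / 2) * m ^ 2 * σ - (5 - σ) * m * (3 - 4 * m))
def kCD (a m σ : ℝ) : ℝ := -(a ^ 3 * m ^ 4 * σ ^ 2 * ((3 - 4 * m) * (1 / 4 - m / 2 - 3 / 2 * m ^ 2)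
   + m * σ ^ 2 * (-1 / 2 - 3 * m)))
def VCD (a m σ : ℝ) : ℝ := -(a ^ 3 * m ^ 4 * σ ^ 2 * (3 - 4 * m))

def QC (f' h V V' h' k k' f v vt vs : ℝ) : ℝ :=
  (f' / 2 - h) * vt ^ 2 + (f' / 2 + h) * vs ^ 2
   + (h * V - f' / 2 * V - f / 2 * V' + k') * v ^ 2 + (h' + 2 * k) * v * vs

def pC (a m σ : ℝ) : ℝ := 1 / 50 * a * m ^ 2 * σ
def qC (a m σ : ℝ) : ℝ := 1 / 20 * a ^ 3 * m ^ 4 * σ ^ 2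

lemma quad_nonneg {P Ch Z : ℝ} (hP : 0 < P) (d : Ch ^ 2 ≤ 4 * P * Z) (x y : ℝ) :
    0 ≤ P * x ^ 2 + Ch * y * x + Z * y ^ 2 := by
  have : 0 ≤ 4 * P * (P * x ^ 2 + Ch * y * x + Z * y ^ 2) := by
    have := mul_le_mul_of_nonneg_right d (sq_nonneg y)
    nlinarith [sq_nonneg (2 * P * x + Ch * y)]
  exact nonneg_of_mul_nonneg_right this (by positivity)

lemma low_aux {m σ : ℝ} (h0 : 0 ≤ σ) (h1 : σ ≤ 1) (hm : m = 1 - σ ^ 2) :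
    0 ≤ σ / 40 + m ^ 2 / 4 - 1 / 50 := by
  have : (1 - σ) ^ 2 ≤ m ^ 2 := by
    apply pow_le_pow_left₀ (by linarith)
    rw [hm]; nlinarith
  nlinarith [sq_nonneg (1 - σ - 1 / 20)]

lemma Q_lower {a m σ : ℝ} (ha : 0 < a) (h0 : 0 ≤ σ) (h1 : σ ≤ 1) (hm : m = 1 - σ ^ 2) (v vt vs : ℝ) :
    pC a m σ * (vt ^ 2 + vs ^ 2) + qC a m σ * v ^ 2 ≤
     QC (fCD a m σ) (hC a m σ) (VC a m σ) (VCD a m σ) (hCD a m σ) (kC a m σ) (kCD a m σ) (fC m σ) v vt vs := by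
  have d := disc_nonneg h0 h1
  rw [← hm] at d
  have hm0 : 0 ≤ m := by rw [hm]; nlinarith
  set P := 2 * (5 - σ) * m + 1 / 10 with hP
  set Ch := -(1/2) * m ^ 2 * σ - (5 - σ) * m * (3 - 4 * m) + 2 * (1/4 - m / 2 - 3/2 * m ^ 2) with hCh
  set Z := 1/2 * (1 - m / 4 - (5 - σ) * m ^ 2) * (3 - 4 * m)
       - 1/8 * m * σ ^ 2 - 1/4 * m ^ 3 * σ
       - (3 - 4 * m) * (1/4 - m / 2 - 3/2 * m ^ 2)
       - m * σ ^ 2 * (-1/2 - 3 * m) - 1/20 with hZ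
  have hP0 : 0 < P := by
    have : 0 ≤ 2 * (5 - σ) * m := mul_nonneg (by linarith) hm0
    linarith
  have quad : 0 ≤ P * vs ^ 2 + Ch * (a * m * v) * vs + Z * (a * m * v) ^ 2 := by
    exact quad_nonneg hP0 d _ _
  have low : 0 ≤ σ / 40 + m ^ 2 / 4 - 1 / 50 := by
    exact low_aux h0 h1 hm
  have k1 : 0 ≤ a * m ^ 2 * σ * (σ / 40 + m ^ 2 / 4 - 1 / 50) * (vt ^ 2 + vs ^ 2) := by positivity
  have k2 : 0 ≤ a * m ^ 2 * σ * (σ / 10) * vt ^ 2 := by positivity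
  have k3 := mul_nonneg (by positivity : 0 ≤ a * m ^ 2 * σ ^ 2) quad
  refine sub_nonneg.1 (le_trans (add_nonneg (add_nonneg k1 k2) k3) (le_of_eq ?_))
  rw [hP, hCh, hZ]
  unfold pC qC QC fCD hC VC VCD hCD kC kCD fC
  ring
end

section
section background
variable {M : ℝ} {r : ℝ → ℝ}

def aM (M : ℝ) : ℝ := 1 / (2 * M)
def sg (M : ℝ) (r : ℝ → ℝ) (s : ℝ) : ℝ := √(1 - muS M r s)

lemma aM_pos (hM : 0 < M) : 0 < aM M := by unfold aM; positivity

lemma r_pos (hM : 0 < M) (hr : IsTortoise M r) (s : ℝ) : 0 < r s :=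
  lt_trans (by positivity) (hr.1 s)

lemma mu_pos (hM : 0 < M) (hr : IsTortoise M r) (s : ℝ) : 0 < muS M r s := by
  have := r_pos hM hr s
  unfold muS; positivity

lemma mu_lt_one (hM : 0 < M) (hr : IsTortoise M r) (s : ℝ) : muS M r s < 1 := by
  unfold muS; rw [div_lt_one (r_pos hM hr s)]; exact hr.1 s

lemma sg_pos (hM : 0 < M) (hr : IsTortoise M r) (s : ℝ) : 0 < sg M r s := by
  unfold sg; apply Real.sqrt_pos.2; linarith [mu_lt_one hM hr s]

lemma sg_sq (hM : 0 < M) (hr : IsTortoise M r) (s : ℝ) : sg M r s ^ 2 = 1 - muS M r s := by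
  unfold sg; rw [Real.sq_sqrt]; linarith [mu_lt_one hM hr s]

lemma sg_lt_one (hM : 0 < M) (hr : IsTortoise M r) (s : ℝ) : sg M r s < 1 := by
  have := sg_sq hM hr s
  have := mu_pos hM hr s
  have := sg_pos hM hr s
  nlinarith

lemma mu_eq (hM : 0 < M) (hr : IsTortoise M r) (s : ℝ) : muS M r s = 1 - sg M r s ^ 2 := by
  linarith [sg_sq hM hr s]

lemma r_mul (hM : 0 < M) (hr : IsTortoise M r) (s : ℝ) : aM M * muS M r s * r s = 1 := by
  have := r_pos hM hr s
  unfold aM muS; field_simp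

lemma hasDeriv_r (hM : 0 < M) (hr : IsTortoise M r) (s : ℝ) : HasDerivAt r (sg M r s ^ 2) s := by
  rw [sg_sq hM hr s]; exact hr.2.1 s

lemma hasDeriv_mu (hM : 0 < M) (hr : IsTortoise M r) (s : ℝ) :
    HasDerivAt (muS M r) (-(aM M * muS M r s ^ 2 * sg M r s ^ 2)) s := by
  have h := (hasDeriv_r hM hr s).inv (r_pos hM hr s).ne'
  have h2 := h.const_mul (2 * M)
  have e : muS M r = fun s => 2 * M * (r s)⁻¹ := by
    funext s; unfold muS; rw [div_eq_mul_inv]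
  have e2 : -(aM M * muS M r s ^ 2 * sg M r s ^ 2) = 2 * M * (-(sg M r s ^ 2) / r s ^ 2) := by
    have := r_pos hM hr s
    unfold aM muS
    field_simp
  rw [e2, e]
  exact h2

lemma hasDeriv_sg (hM : 0 < M) (hr : IsTortoise M r) (s : ℝ) :
    HasDerivAt (sg M r) (1 / 2 * aM M * muS M r s ^ 2 * sg M r s) s := by
  have h := ((hasDeriv_mu hM hr s).const_sub 1).sqrt (by linarith [mu_lt_one hM hr s])
  refine h.congr_deriv ?_
  have := sg_pos hM hr s
  change -(-(aM M * muS M r s ^ 2 * sg M r s ^ 2)) / (2 * sg M r s) = _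
  field_simp

lemma r_contDiff (hM : 0 < M) (hr : IsTortoise M r) : ContDiff ℝ (⊤ : ℕ∞) r := by
  rw [contDiff_infty]
  intro n
  induction n with
  | zero => 
    rw [Nat.cast_zero, contDiff_zero]
    exact continuous_iff_continuousAt.2 fun s => (hr.2.1 s).continuousAt
  | succ n ih =>
    push_cast
    rw [contDiff_succ_iff_deriv]
    refine ⟨fun s => (hr.2.1 s).differentiableAt, by simp, ?_⟩
    have : deriv r = fun s => 1 - 2 * M / r s := by funext s; exact (hr.2.1 s).deriv
    rw [this]
    exact contDiff_const.sub (contDiff_const.div ih fun s => (r_pos hM hr s).ne')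

lemma mu_contDiff (hM : 0 < M) (hr : IsTortoise M r) : ContDiff ℝ (⊤ : ℕ∞) (muS M r) := by
  unfold muS
  exact contDiff_const.div (r_contDiff hM hr) fun s => (r_pos hM hr s).ne'

lemma sg_contDiff (hM : 0 < M) (hr : IsTortoise M r) : ContDiff ℝ (⊤ : ℕ∞) (sg M r) := by
  unfold sg
  exact (contDiff_const.sub (mu_contDiff hM hr)).sqrt fun s => by linarith [mu_lt_one hM hr s]

lemma r_mono (hM : 0 < M) (hr : IsTortoise M r) : Monotone r := by
  apply monotone_of_deriv_nonneg
  · exact fun s => (hr.2.1 s).differentiableAt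
  · intro s; rw [(hasDeriv_r hM hr s).deriv]; positivity

lemma r_le (hM : 0 < M) (hr : IsTortoise M r) {s : ℝ} (hs : 0 ≤ s) : r s ≤ 3 * M + s := by
  have hm : Monotone (fun x => x - r x) := by
    have hd : ∀ x, HasDerivAt (fun x => x - r x) (1 - sg M r x ^ 2) x := fun x =>
      (hasDerivAt_id x).sub (hasDeriv_r hM hr x)
    apply monotone_of_deriv_nonneg
    · exact fun x => (hd x).differentiableAt
    · intro x; rw [(hd x).deriv, ← mu_eq hM hr]; exact (mu_pos hM hr x).le
  have := hm hs
  simp only [hr.2.2] at this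
  linarith

lemma le_r (hM : 0 < M) (hr : IsTortoise M r) {s : ℝ} (hs : 0 ≤ s) : 3 * M + s / 3 ≤ r s := by
  have hd : ∀ x, HasDerivAt (fun x => r x - x / 3) (sg M r x ^ 2 - 1 / 3) x := fun x =>
      (hasDeriv_r hM hr x).sub ((hasDerivAt_id x).div_const 3)
  have hm : MonotoneOn (fun x => r x - x / 3) (Set.Ici 0) := by
    apply monotoneOn_of_deriv_nonneg (convex_Ici 0)
    · exact fun x _ => (hd x).continuousAt.continuousWithinAt
    · exact fun x _ => (hd x).differentiableAt.differentiableWithinAt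
    · intro x hx
      rw [interior_Ici] at hx
      rw [(hd x).deriv, sg_sq hM hr]
      have h3 : 3 * M ≤ r x := by rw [← hr.2.2]; exact r_mono hM hr hx.le
      have : muS M r x ≤ 2 / 3 := by
        unfold muS; rw [div_le_iff₀ (r_pos hM hr x)]; linarith
      linarith
  have := hm Set.self_mem_Ici hs hs
  simp only [hr.2.2] at this
  linarith

lemma r_le_neg (hM : 0 < M) (hr : IsTortoise M r) {s : ℝ} (hs : s ≤ 0) : r s ≤ 3 * M := by
  rw [← hr.2.2]; exact r_mono hM hr hs

lemma sg_exp (hM : 0 < M) (hr : IsTortoise M r) {s : ℝ} (hs : s ≤ 0) :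
    sg M r s ^ 2 ≤ 1 / 3 * exp (2 * s / (9 * M)) := by
  have hd : ∀ x, HasDerivAt (fun x => (1 - muS M r x) * exp (-(2 * x / (9 * M))))
      (-(-(aM M * muS M r x ^ 2 * sg M r x ^ 2)) * exp (-(2 * x / (9 * M))) +
        (1 - muS M r x) * (exp (-(2 * x / (9 * M))) * (-(2 * 1 / (9 * M))))) x := fun x =>
      ((hasDeriv_mu hM hr x).const_sub 1).mul
        ((((hasDerivAt_id x).const_mul 2).div_const (9 * M)).neg.exp)
  have hm : MonotoneOn (fun x => (1 - muS M r x) * exp (-(2 * x / (9 * M)))) (Set.Iic 0) := by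
    apply monotoneOn_of_deriv_nonneg (convex_Iic 0)
    · exact fun x _ => (hd x).continuousAt.continuousWithinAt
    · exact fun x _ => (hd x).differentiableAt.differentiableWithinAt
    · intro x hx
      rw [interior_Iic] at hx
      rw [(hd x).deriv, ← sg_sq hM hr]
      have h3 := r_le_neg hM hr hx.le
      have h4 : 2 / 3 ≤ muS M r x := by
        unfold muS; rw [le_div_iff₀ (r_pos hM hr x)]; linarith
      have h5 : 2 * 1 / (9 * M) ≤ aM M * muS M r x ^ 2 := by
        calc 2 * 1 / (9 * M) = 1 / (2 * M) * (2 / 3) ^ 2 := by field_simp; norm_num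
          _ ≤ _ := by unfold aM; gcongr
      have : 0 ≤ (aM M * muS M r x ^ 2 - 2 * 1 / (9 * M)) * (sg M r x ^ 2 * exp (-(2 * x / (9 * M)))) :=
        mul_nonneg (by linarith) (by positivity)
      linarith
  have := hm (Set.mem_Iic.2 hs) Set.self_mem_Iic hs
  simp only [muS, hr.2.2] at this
  rw [sg_sq hM hr]
  have h6 : (1 - 2 * M / (3 * M)) = 1 / 3 := by field_simp; norm_num
  rw [h6] at this
  simp only [mul_zero, zero_div, neg_zero, exp_zero, mul_one] at this
  rw [exp_neg, ← div_eq_mul_inv, div_le_iff₀ (exp_pos _)] at this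
  exact this

/-- `√(1-μ) (s/r)² ≤ 41` -/
lemma sg_b (hM : 0 < M) (hr : IsTortoise M r) (s : ℝ) :
    sg M r s * (aM M * muS M r s * s) ^ 2 ≤ 41 := by
  have h0 := sg_pos hM hr s
  have h1 := sg_lt_one hM hr s
  have hm0 := mu_pos hM hr s
  have hm1 := mu_lt_one hM hr s
  have ha := aM_pos hM
  rcases le_total 0 s with hs | hs
  · have h3 := le_r hM hr hs
    have : aM M * muS M r s * s ≤ 3 := by
      have e := r_mul hM hr s
      have : 0 < aM M * muS M r s := by positivity
      nlinarith
    have h5 : 0 ≤ aM M * muS M r s * s := by positivity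
    nlinarith
  · have e := sg_exp hM hr hs
    set y := -(s / (9 * M)) with hy
    have hy0 : 0 ≤ y := by rw [hy, neg_nonneg]; exact div_nonpos_of_nonpos_of_nonneg hs (by positivity)
    have e2 : sg M r s ≤ exp (-y) := by
      apply le_of_sq_le_sq _ (exp_pos _).le |> fun h => h
      rw [← exp_nat_mul]
      refine e.trans ?_
      have : ((2 : ℕ) : ℝ) * -y = 2 * s / (9 * M) := by rw [hy]; push_cast; ring
      rw [this]
      linarith [exp_pos (2 * s / (9 * M))]
    have e3 := Real.quadratic_le_exp_of_nonneg hy0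
    have e4 : exp (-y) * exp y = 1 := by rw [← exp_add]; simp
    have hsy : aM M * s = -(9 / 2) * y := by rw [hy]; unfold aM; field_simp
    calc sg M r s * (aM M * muS M r s * s) ^ 2 = sg M r s * (muS M r s ^ 2 * (aM M * s) ^ 2) := by ring
      _ ≤ exp (-y) * (1 ^ 2 * (aM M * s) ^ 2) := by gcongr
      _ = 81 / 4 * (exp (-y) * y ^ 2) := by rw [hsy]; ring
      _ ≤ 81 / 4 * (exp (-y) * (2 * exp y)) := by gcongr; nlinarith
      _ = 81 / 4 * 2 * (exp (-y) * exp y) := by ring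
      _ ≤ 41 := by rw [e4]; norm_num

/-- the potential for the commutator `[□, S]` -/
def WC (a m σ s : ℝ) : ℝ := VC a m σ * (2 + a * m * s * (4 * m - 3))

lemma W_nonpos (hM : 0 < M) (hr : IsTortoise M r) {s : ℝ} (hs : 30 * M ≤ |s|) :
    WC (aM M) (muS M r s) (sg M r s) s ≤ 0 := by
  have hV : 0 ≤ VC (aM M) (muS M r s) (sg M r s) := by
    have := mu_pos hM hr s
    unfold VC; positivity
  apply mul_nonpos_of_nonneg_of_nonpos hV
  have e := r_mul hM hr s
  have hm0 := mu_pos hM hr s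
  have ha := aM_pos hM
  have ham : 0 < aM M * muS M r s := by positivity
  have hmr : muS M r s * r s = 2 * M := by
    have := r_pos hM hr s
    unfold muS; field_simp
  rcases le_total 0 s with h0 | h0
  · rw [abs_of_nonneg h0] at hs
    have h1 := r_le hM hr h0
    have h2 := le_r hM hr h0
    have b1 : 10 / 11 ≤ aM M * muS M r s * s := by nlinarith
    have b2 : muS M r s ≤ 2 / 13 := by
      unfold muS; rw [div_le_iff₀ (r_pos hM hr s)]; linarith
    nlinarith
  · rw [abs_of_nonpos h0] at hs
    have h1 := r_le_neg hM hr h0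
    have b1 : aM M * muS M r s * s ≤ -10 := by nlinarith
    have e1 := sg_exp hM hr h0
    rw [sg_sq hM hr] at e1
    have e2 : exp (2 * s / (9 * M)) ≤ 1 / 4 := by
      have : 2 * s / (9 * M) = -(2 * (-s) / (9 * M)) := by ring
      rw [this, exp_neg]
      rw [inv_le_comm₀ (exp_pos _) (by norm_num)]
      have h7 := add_one_le_exp (2 * (-s) / (9 * M))
      have h8 : 6 ≤ 2 * (-s) / (9 * M) := by rw [le_div_iff₀ (by positivity)]; linarith
      have : (1 / 4 : ℝ)⁻¹ = 4 := by norm_num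
      linarith
    nlinarith

lemma g_sq_bound {b m : ℝ} (hm0 : 0 < m) (hm1 : m < 1) :
    (2 + b * (4 * m - 3)) ^ 2 ≤ 8 + 18 * b ^ 2 := by
  have : (4 * m - 3) ^ 2 ≤ 9 := by nlinarith
  have h2 : b ^ 2 * (4 * m - 3) ^ 2 ≤ b ^ 2 * 9 := by gcongr
  nlinarith [sq_nonneg (2 - b * (4 * m - 3))]

/-- bounds for coefficients, at a point -/
structure CB (C R s V W f h k p q : ℝ) : Prop where
  hV : 0 ≤ V
  hp : 0 ≤ p
  hq : 0 ≤ q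
  hf : |f| ≤ C
  hh : h ^ 2 ≤ C * V
  hk : |k| ≤ C * V
  hpq : W ^ 2 ≤ C * p * q
  hWh : (W * h) ^ 2 ≤ C * q ^ 2
  hWq : |s| ≤ R → W ≤ C * q
  hWR : R ≤ |s| → W ≤ 0
  hsW : s ^ 2 * W ^ 2 ≤ C * V

lemma CB.mono {C C' R s V W f h k p q : ℝ} (H : CB C R s V W f h k p q) (hC : C ≤ C') :
    CB C' R s V W f h k p q := by
  obtain ⟨hV, hp, hq, hf, hh, hk, hpq, hWh, hWq, hWR, hsW⟩ := H
  refine ⟨hV, hp, hq, hf.trans hC, hh.trans (by gcongr), hk.trans (by gcongr), hpq.trans (by gcongr),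
    hWh.trans (by gcongr), fun hs => (hWq hs).trans (by gcongr), hWR, hsW.trans (by gcongr)⟩

lemma coef_bounds (hM : 0 < M) (hr : IsTortoise M r) (s : ℝ) :
    CB (10 ^ 8 * (1 + M)) (30 * M) s (VC (aM M) (muS M r s) (sg M r s))
      (WC (aM M) (muS M r s) (sg M r s) s)
      (fC (muS M r s) (sg M r s)) (hC (aM M) (muS M r s) (sg M r s))
      (kC (aM M) (muS M r s) (sg M r s)) (pC (aM M) (muS M r s) (sg M r s))
      (qC (aM M) (muS M r s) (sg M r s)) := by
  have hb := sg_b hM hr s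
  have e := r_mul hM hr s
  have hWR := fun h => W_nonpos (s := s) hM hr h
  have hrl : s ≤ 30 * M → r s ≤ 33 * M := by
    intro hs
    have h1 := r_mono hM hr hs
    have h2 := r_le hM hr (s := 30 * M) (by positivity)
    linarith
  have h0 := sg_pos hM hr s
  have h1 := sg_lt_one hM hr s
  have hm0 := mu_pos hM hr s
  have hm1 := mu_lt_one hM hr s
  have ha := aM_pos hM
  have hrp := r_pos hM hr s
  generalize hm : muS M r s = m at *
  generalize sg M r s = σ at *
  generalize aM M = a at *
  generalize r s = ρ at *
  have hVp : 0 < VC a m σ := by unfold VC; positivity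
  have hg := g_sq_bound (b := a * m * s) hm0 hm1
  have hσg : σ * (2 + a * m * s * (4 * m - 3)) ^ 2 ≤ 746 := by
    calc _ ≤ σ * (8 + 18 * (a * m * s) ^ 2) := by gcongr
      _ = 8 * σ + 18 * (σ * (a * m * s) ^ 2) := by ring
      _ ≤ _ := by linarith
  have hC1 : (10 ^ 8 : ℝ) ≤ 10 ^ 8 * (1 + M) := by linarith
  have hm5 : (5 - σ) ^ 2 ≤ 25 := by nlinarith
  refine ⟨hVp.le, by unfold pC; positivity, by unfold qC; positivity, ?_, ?_, ?_, ?_, ?_, ?_, ?_, ?_⟩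
  · have : |fC m σ| ≤ 7 := by
      have hm2 : m ^ 2 ≤ 1 := by nlinarith
      have h3 : (5 - σ) * m ^ 2 ≤ 5 * 1 := by gcongr <;> linarith
      have h4 : 0 ≤ (5 - σ) * m ^ 2 := mul_nonneg (by linarith) (sq_nonneg m)
      unfold fC; rw [abs_le]; constructor <;> linarith
    linarith
  · have : hC a m σ ^ 2 ≤ 25 * VC a m σ := by
      calc _ = (5 - σ) ^ 2 * (m ^ 3 * σ ^ 2) * VC a m σ := by unfold hC VC; ring
        _ ≤ 25 * (1 ^ 3 * 1 ^ 2) * VC a m σ := by gcongr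
        _ = _ := by ring
    nlinarith
  · have h3 : |1 / 4 - m / 2 - 3 / 2 * m ^ 2| ≤ 3 := by rw [abs_le]; constructor <;> nlinarith
    have : |kC a m σ| ≤ 3 * VC a m σ := by
      have : kC a m σ = VC a m σ * (1 / 4 - m / 2 - 3 / 2 * m ^ 2) := by unfold kC VC; ring
      rw [this, abs_mul, abs_of_pos hVp, mul_comm 3]; gcongr
    nlinarith
  · calc WC a m σ s ^ 2 = a ^ 4 * m ^ 6 * σ ^ 3 * (σ * (2 + a * m * s * (4 * m - 3)) ^ 2) := by
          unfold WC VC; ring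
      _ ≤ a ^ 4 * m ^ 6 * σ ^ 3 * 746 := by gcongr
      _ ≤ a ^ 4 * m ^ 6 * σ ^ 3 * (10 ^ 8 * (1 + M) / 1000) := by gcongr; linarith
      _ = _ := by unfold pC qC; ring
  · calc (WC a m σ s * hC a m σ) ^ 2 = a ^ 6 * m ^ 8 * σ ^ 4 * (m ^ 4 * σ ^ 3 * ((5 - σ) ^ 2 * (σ * (2 + a * m * s * (4 * m - 3)) ^ 2))) := by
          unfold WC VC hC; ring
      _ ≤ a ^ 6 * m ^ 8 * σ ^ 4 * (1 ^ 4 * 1 ^ 3 * (25 * 746)) := by gcongr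
      _ ≤ a ^ 6 * m ^ 8 * σ ^ 4 * (10 ^ 8 * (1 + M) / 400) := by gcongr; linarith
      _ = _ := by unfold qC; ring
  · intro hs
    have hs2 := abs_le.1 hs
    have hr1 := hrl hs2.2
    have gb : 2 + a * m * s * (4 * m - 3) ≤ a * m * (156 * M) := by
      have : s * (4 * m - 3) ≤ 90 * M := by
        calc _ ≤ |s * (4 * m - 3)| := le_abs_self _
          _ = |s| * |4 * m - 3| := abs_mul _ _
          _ ≤ (30 * M) * 3 := by
            gcongr
            rw [abs_le]; constructor <;> linarith
          _ = _ := by ring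
      calc _ = a * m * (2 * ρ + s * (4 * m - 3)) := by linear_combination (-2) * e
        _ ≤ _ := by gcongr; linarith
    calc WC a m σ s ≤ VC a m σ * (a * m * (156 * M)) := by unfold WC; gcongr
      _ = a ^ 3 * m ^ 4 * σ ^ 2 * (156 * M) := by unfold VC; ring
      _ ≤ a ^ 3 * m ^ 4 * σ ^ 2 * (10 ^ 8 * (1 + M) / 20) := by gcongr; linarith
      _ = _ := by unfold qC; ring
  · exact hWR
  · calc s ^ 2 * WC a m σ s ^ 2 = VC a m σ * (m * (σ * (a * m * s) ^ 2) * (σ * (2 + a * m * s * (4 * m - 3)) ^ 2)) := by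
          unfold WC VC; ring
      _ ≤ VC a m σ * (1 * 41 * 746) := by gcongr
      _ ≤ VC a m σ * (10 ^ 8 * (1 + M)) := mul_le_mul_of_nonneg_left (by linarith) hVp.le
      _ = _ := by ring
end background
end

section
lemma div_lemma (N J : ℝ × ℝ → ℝ) (hN : ContDiffOn ℝ 1 N {p | 0 < p.1})
    (hJ : ContDiffOn ℝ 1 J {p | 0 < p.1}) (Nt Js : ℝ → ℝ → ℝ)
    (hNt : ∀ t s, 0 < t → HasDerivAt (fun t' => N (t', s)) (Nt t s) t)
    (hJs : ∀ t s, 0 < t → HasDerivAt (fun s' => J (t, s')) (Js t s) s)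
    {t1 t2 A X : ℝ} (h1 : 0 < t1) (h12 : t1 ≤ t2) (hX : 0 ≤ X)
    (hle : ∀ t s, t1 ≤ t → t ≤ t2 → Nt t s ≤ Js t s)
    (hl : ∀ t, t1 ≤ t → t ≤ t2 → 0 ≤ N (t, A + t) + J (t, A + t))
    (hrt : ∀ t, t1 ≤ t → t ≤ t2 → N (t, A + t + X) + J (t, A + t + X) = 0) :
    ∫ x in (0:ℝ)..X, N (t2, A + t2 + x) ≤ ∫ x in (0:ℝ)..X, N (t1, A + t1 + x) := by
  have hU : IsOpen {p : ℝ × ℝ | 0 < p.1} := isOpen_lt continuous_const continuous_fst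
  set Φ : ℝ × ℝ → ℝ × ℝ := fun p => (p.1, A + p.1 + p.2) with hΦ
  have hΦc : ContDiff ℝ 1 Φ := by rw [hΦ]; fun_prop
  have hmaps : Set.MapsTo Φ {p | 0 < p.1} {p | 0 < p.1} := fun p hp => hp
  have hf : ContDiffOn ℝ 1 (N ∘ Φ) {p | 0 < p.1} := hN.comp hΦc.contDiffOn hmaps
  have hg0 : ContDiffOn ℝ 1 (J ∘ Φ) {p | 0 < p.1} := hJ.comp hΦc.contDiffOn hmaps
  have hg : ContDiffOn ℝ 1 (fun p => -((N ∘ Φ) p + (J ∘ Φ) p)) {p | 0 < p.1} := (hf.add hg0).neg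
  have hsub : Set.Icc ((t1, 0) : ℝ × ℝ) (t2, X) ⊆ {p | 0 < p.1} := by
    rintro ⟨t, x⟩ ⟨ha, hb⟩
    exact lt_of_lt_of_le h1 ha.1
  have hdf : ∀ p : ℝ × ℝ, 0 < p.1 → HasFDerivAt (N ∘ Φ) (fderiv ℝ (N ∘ Φ) p) p := fun p hp =>
    (((hf.contDiffAt (hU.mem_nhds hp)).differentiableAt (by norm_num))).hasFDerivAt
  have hdg0 : ∀ p : ℝ × ℝ, 0 < p.1 → HasFDerivAt (J ∘ Φ) (fderiv ℝ (J ∘ Φ) p) p := fun p hp =>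
    (((hg0.contDiffAt (hU.mem_nhds hp)).differentiableAt (by norm_num))).hasFDerivAt
  have hdg : ∀ p : ℝ × ℝ, 0 < p.1 → HasFDerivAt (fun p => -((N ∘ Φ) p + (J ∘ Φ) p))
      (-(fderiv ℝ (N ∘ Φ) p + fderiv ℝ (J ∘ Φ) p)) p := fun p hp => ((hdf p hp).add (hdg0 p hp)).neg
  have cN : ContinuousOn (fderiv ℝ (N ∘ Φ)) {p | 0 < p.1} := hf.continuousOn_fderiv_of_isOpen hU le_rfl
  have cJ : ContinuousOn (fderiv ℝ (J ∘ Φ)) {p | 0 < p.1} := hg0.continuousOn_fderiv_of_isOpen hU le_rfl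
  have main := integral_divergence_prod_Icc_of_hasFDerivAt_of_le (N ∘ Φ) (fun p => -((N ∘ Φ) p + (J ∘ Φ) p))
    (fderiv ℝ (N ∘ Φ)) (fun p => -(fderiv ℝ (N ∘ Φ) p + fderiv ℝ (J ∘ Φ) p)) (t1, 0) (t2, X)
    (Prod.mk_le_mk.2 ⟨h12, hX⟩) (hf.continuousOn.mono hsub) (hg.continuousOn.mono hsub)
    (fun p hp => hdf p (h1.trans hp.1.1)) (fun p hp => hdg p (h1.trans hp.1.1))
    (by
      apply ContinuousOn.integrableOn_compact isCompact_Icc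
      refine ContinuousOn.mono ?_ hsub
      exact (cN.clm_apply continuousOn_const).add ((cN.add cJ).neg.clm_apply continuousOn_const))
  have neg : (∫ x in Set.Icc ((t1, 0) : ℝ × ℝ) (t2, X), (fderiv ℝ (N ∘ Φ) x) (1, 0) +
      (-(fderiv ℝ (N ∘ Φ) x + fderiv ℝ (J ∘ Φ) x)) (0, 1)) ≤ 0 := by
    apply setIntegral_nonpos measurableSet_Icc
    intro p hp
    have hp0 := hsub hp
    have hq : Φ p ∈ {p : ℝ × ℝ | 0 < p.1} := hmaps hp0
    have dN : HasFDerivAt N (fderiv ℝ N (Φ p)) (Φ p) :=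
      ((hN.contDiffAt (hU.mem_nhds hq)).differentiableAt (by norm_num)).hasFDerivAt
    have dJ : HasFDerivAt J (fderiv ℝ J (Φ p)) (Φ p) :=
      ((hJ.contDiffAt (hU.mem_nhds hq)).differentiableAt (by norm_num)).hasFDerivAt
    have dΦ : HasFDerivAt Φ ((ContinuousLinearMap.fst ℝ ℝ ℝ).prod
      (ContinuousLinearMap.fst ℝ ℝ ℝ + ContinuousLinearMap.snd ℝ ℝ ℝ)) p := by
      refine HasFDerivAt.prodMk hasFDerivAt_fst ?_
      exact (hasFDerivAt_fst.const_add A).add hasFDerivAt_snd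
    have e1 := (dN.comp p dΦ).fderiv
    have e2 := (dJ.comp p dΦ).fderiv
    rw [e1, e2]
    have l1 : (fderiv ℝ N (Φ p)) (1, 0) = Nt p.1 (A + p.1 + p.2) := by
      have := dN.comp_hasDerivAt (x := p.1) (f := fun t' => (t', A + p.1 + p.2))
        ((hasDerivAt_id p.1).prodMk (hasDerivAt_const _ _))
      exact this.unique (hNt _ _ hp0)
    have l2 : (fderiv ℝ J (Φ p)) (0, 1) = Js p.1 (A + p.1 + p.2) := by
      have := dJ.comp_hasDerivAt (x := A + p.1 + p.2) (f := fun s' => (p.1, s'))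
        ((hasDerivAt_const _ _).prodMk (hasDerivAt_id (A + p.1 + p.2)))
      exact this.unique (hJs _ _ hp0)
    have l3 : (fderiv ℝ N (Φ p)) (1, 1) = (fderiv ℝ N (Φ p)) (1, 0) + (fderiv ℝ N (Φ p)) (0, 1) := by
      rw [← map_add]; simp
    have := hle p.1 (A + p.1 + p.2) hp.1.1 hp.2.1
    simp [l1, l2, l3]
    linarith
  rw [main] at neg
  have hA : ∫ x in t1..t2, -((N ∘ Φ) (x, X) + (J ∘ Φ) (x, X)) = 0 := by
    rw [intervalIntegral.integral_congr (g := fun _ => (0:ℝ))]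
    · simp
    · intro t ht
      rw [Set.uIcc_of_le h12] at ht
      have := hrt t ht.1 ht.2
      simp [hΦ, this]
  have hB : ∫ x in t1..t2, -((N ∘ Φ) (x, 0) + (J ∘ Φ) (x, 0)) ≤ 0 := by
    rw [intervalIntegral.integral_neg, neg_nonpos]
    apply intervalIntegral.integral_nonneg h12
    intro t ht
    have := hl t ht.1 ht.2
    simpa [hΦ] using this
  have neg' : (∫ x in t1..t2, -((N ∘ Φ) (x, X) + (J ∘ Φ) (x, X))) -
     (∫ x in t1..t2, -((N ∘ Φ) (x, 0) + (J ∘ Φ) (x, 0))) + (∫ x in (0:ℝ)..X, N (t2, A + t2 + x)) -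
     (∫ x in (0:ℝ)..X, N (t1, A + t1 + x)) ≤ 0 := neg
  linarith
end

section
lemma exists_cutoff : ∃ (χ : ℝ → ℝ) (K : ℝ), 0 ≤ K ∧ ContDiff ℝ (⊤ : ℕ∞) χ ∧ (∀ y, 0 ≤ χ y) ∧
    (∀ y, χ y ≤ 1) ∧ (∀ y, |y| ≤ 1 / 4 → χ y = 1) ∧ (∀ y, 1 / 2 < |y| → χ y = 0 ∧ deriv χ y = 0) ∧
    (∀ y, |deriv χ y| ≤ K) := by
  let b : ContDiffBump (0 : ℝ) := ⟨1 / 4, 1 / 2, by norm_num, by norm_num⟩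
  have hc : ContDiff ℝ (⊤ : ℕ∞) b := b.contDiff
  have hd : Continuous (deriv b) := hc.continuous_deriv (by norm_num)
  have hs : HasCompactSupport (deriv b) := b.hasCompactSupport.deriv
  obtain ⟨K, hK⟩ := hs.exists_bound_of_continuous hd
  refine ⟨b, K, (norm_nonneg _).trans (hK 0), hc, fun y => b.nonneg, fun y => b.le_one, ?_, ?_, hK⟩
  · intro y hy
    apply b.one_of_mem_closedBall
    simpa [b] using hy
  · intro y hy
    have h0 : ∀ z : ℝ, 1 / 2 < |z| → b z = 0 := fun z hz => by
      apply b.zero_of_le_dist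
      simpa [b] using hz.le
    refine ⟨h0 y hy, ?_⟩
    have : (b : ℝ → ℝ) =ᶠ[nhds y] fun _ => (0:ℝ) := by
      filter_upwards [(isOpen_lt continuous_const continuous_abs).mem_nhds hy] with z hz
      exact h0 z hz
    rw [this.deriv_eq]; simp

/-- weighted density for one field -/
def dens (δ c τ s V f h X v vt vs : ℝ) : ℝ :=
  τ ^ (-δ) * (eKd τ s V v vt vs + c * τ ^ 2 * X * m0d f h v vt vs)
/-- weighted flux for one field -/
def flux (δ c τ s V f h k X v vt vs : ℝ) : ℝ :=
  τ ^ (-δ) * (jKd τ s V v vt vs + c * τ ^ 2 * X * j0d f h k V v vt vs)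

def densT (δ c τ s V f h X Xt v vt vs vtt vts : ℝ) : ℝ :=
  τ ^ (-δ) * (-δ / τ * (eKd τ s V v vt vs + c * τ ^ 2 * X * m0d f h v vt vs)
    + ((2 * (τ + s) * (vt + vs) ^ 2 + (τ + s) ^ 2 * (2 * (vt + vs) * (vtt + vts))
        + (2 * (τ - s) * (vt - vs) ^ 2 + (τ - s) ^ 2 * (2 * (vt - vs) * (vtt - vts)))) / 4
      + τ * V * v ^ 2 + (τ ^ 2 + s ^ 2) * V * v * vt)
    + c * (2 * τ * X * m0d f h v vt vs + τ ^ 2 * (Xt * m0d f h v vt vs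
       + X * (vtt * (f * vs + h * v) + vt * (f * vts + h * vt)))))

def fluxS (δ c τ s V V' f f' h h' k k' X Xs v vt vs vts vss : ℝ) : ℝ :=
  τ ^ (-δ) * ((2 * s * vt * vs + (τ ^ 2 + s ^ 2) * (vts * vs + vt * vss)
      + τ * (vt ^ 2 + vs ^ 2 - V * v ^ 2)
      + τ * s * (2 * vt * vts + 2 * vs * vss - V' * v ^ 2 - 2 * V * v * vs))
    + c * τ ^ 2 * (Xs * j0d f h k V v vt vs
      + X * (f' / 2 * (vt ^ 2 + vs ^ 2 - V * v ^ 2)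
        + f / 2 * (2 * vt * vts + 2 * vs * vss - V' * v ^ 2 - 2 * V * v * vs)
        + h' * v * vs + h * vs ^ 2 + h * v * vss + k' * v ^ 2 + 2 * k * v * vs)))

lemma dens_identity {δ c τ s V V' W f f' h h' k k' X Xt Xs F v vt vs vtt vts vss : ℝ}
    (hW : W = 2 * V + s * V') (heq : vtt = vss - V * v + F) :
    densT δ c τ s V f h X Xt v vt vs vtt vts - fluxS δ c τ s V V' f f' h h' k k' X Xs v vt vs vts vss =
     τ ^ (-δ) * Rd δ c τ s V W f h k X Xt Xs (QC f' h V V' h' k k' f v vt vs) F v vt vs := by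
  unfold densT fluxS Rd
  rw [← mul_sub]
  congr 1
  rw [heq, hW]
  unfold QC m0d j0d Kd
  ring

lemma hasDeriv_dens {δ c T s V f h t vtt vts : ℝ} {v vt vs : ℝ → ℝ} {χ : ℝ → ℝ}
    (hτ : 0 < t + T) (hχ : Differentiable ℝ χ)
    (h1 : HasDerivAt v (vt t) t) (h2 : HasDerivAt vt vtt t) (h3 : HasDerivAt vs vts t) :
    HasDerivAt (fun t' => dens δ c (t' + T) s V f h (χ (s / (t' + T))) (v t') (vt t') (vs t'))
      (densT δ c (t + T) s V f h (χ (s / (t + T))) (-(deriv χ (s / (t + T)) * (s / (t + T) ^ 2)))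
        (v t) (vt t) (vs t) vtt vts) t := by
  have hτ' : HasDerivAt (fun t' => t' + T) 1 t := (hasDerivAt_id t).add_const T
  have hX : HasDerivAt (fun t' => χ (s / (t' + T))) (-(deriv χ (s / (t + T)) * (s / (t + T) ^ 2))) t := by
    have := (hχ (s / (t + T))).hasDerivAt.comp t ((hasDerivAt_const t s).div hτ' hτ.ne')
    refine this.congr_deriv ?_
    simp; ring
  have hp : HasDerivAt (fun t' => (t' + T) ^ (-δ)) ((t + T) ^ (-δ) * (-δ / (t + T))) t := by
    have := hτ'.rpow_const (p := -δ) (Or.inl hτ.ne')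
    refine this.congr_deriv ?_
    rw [Real.rpow_sub_one hτ.ne']; ring
  have hm : HasDerivAt (fun t' => m0d f h (v t') (vt t') (vs t'))
      (vtt * (f * vs t + h * v t) + vt t * (f * vts + h * vt t)) t := 
    h2.mul ((h3.const_mul f).add (h1.const_mul h))
  have he : HasDerivAt (fun t' => eKd (t' + T) s V (v t') (vt t') (vs t')) 
     (((2 * (t + T + s) * (vt t + vs t) ^ 2 + (t + T + s) ^ 2 * (2 * (vt t + vs t) * (vtt + vts))
        + (2 * (t + T - s) * (vt t - vs t) ^ 2 + (t + T - s) ^ 2 * (2 * (vt t - vs t) * (vtt - vts)))) / 4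
      + (t + T) * V * v t ^ 2 + ((t + T) ^ 2 + s ^ 2) * V * v t * vt t)) t := by
    have a1 := ((hτ'.add_const s).fun_pow 2).mul ((h2.add h3).fun_pow 2)
    have a2 := ((hτ'.sub_const s).fun_pow 2).mul ((h2.sub h3).fun_pow 2)
    have a3 := ((((hτ'.fun_pow 2).add_const (s ^ 2)).div_const 2).mul_const V).mul (h1.fun_pow 2)
    refine (((a1.add a2).div_const 4).add a3).congr_deriv ?_
    simp; ring
  have tot := hp.mul (he.add ((((hτ'.fun_pow 2).const_mul c).mul hX).mul hm))
  refine tot.congr_deriv ?_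
  unfold densT
  simp; ring

lemma hasDeriv_flux {δ c τ t s vts vss : ℝ} {v vt vs V f h k : ℝ → ℝ} {V' f' h' k' : ℝ} {χ : ℝ → ℝ}
    (hτ : 0 < τ) (hχ : Differentiable ℝ χ)
    (hV : HasDerivAt V V' s) (hf : HasDerivAt f f' s) (hh : HasDerivAt h h' s) (hk : HasDerivAt k k' s)
    (h1 : HasDerivAt v (vs s) s) (h2 : HasDerivAt vt vts s) (h3 : HasDerivAt vs vss s) :
    HasDerivAt (fun s' => flux δ c τ s' (V s') (f s') (h s') (k s') (χ (s' / τ)) (v s') (vt s') (vs s'))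
      (fluxS δ c τ s (V s) V' (f s) f' (h s) h' (k s) k' (χ (s / τ)) (deriv χ (s / τ) / τ)
        (v s) (vt s) (vs s) vts vss) s := by
  have hX : HasDerivAt (fun s' => χ (s' / τ)) (deriv χ (s / τ) / τ) s := by
    have := (hχ (s / τ)).hasDerivAt.comp s ((hasDerivAt_id s).div_const τ)
    refine this.congr_deriv ?_
    ring
  have hsq := ((h2.fun_pow 2).add (h3.fun_pow 2)).sub (hV.mul (h1.fun_pow 2))
  have hj := (((hf.div_const 2).mul hsq).add ((hh.mul h1).mul h3)).add (hk.mul (h1.fun_pow 2))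
  have hjK := ((((((hasDerivAt_id s).fun_pow 2).const_add (τ ^ 2)).mul h2).mul h3)).add
    (((hasDerivAt_id s).const_mul τ).mul hsq)
  have tot := (hjK.add ((hX.const_mul (c * τ ^ 2)).mul hj)).const_mul (τ ^ (-δ))
  refine tot.congr_deriv ?_
  unfold fluxS j0d
  simp only [Pi.add_apply, Pi.mul_apply, Pi.sub_apply, id]
  push_cast
  ring

section smooth
variable {v : ℝ → ℝ → ℝ}

lemma pd_t_eq (hv : ContDiff ℝ (⊤ : ℕ∞) (Function.uncurry v)) (t s : ℝ) :
    HasDerivAt (fun t' => v t' s) (fderiv ℝ (Function.uncurry v) (t, s) (1, 0)) t := by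
  have d := (hv.differentiable (by norm_num) (t, s)).hasFDerivAt
  exact d.comp_hasDerivAt (x := t) (f := fun t' => (t', s)) ((hasDerivAt_id t).prodMk (hasDerivAt_const _ _))

lemma pd_s_eq (hv : ContDiff ℝ (⊤ : ℕ∞) (Function.uncurry v)) (t s : ℝ) :
    HasDerivAt (fun s' => v t s') (fderiv ℝ (Function.uncurry v) (t, s) (0, 1)) s := by
  have d := (hv.differentiable (by norm_num) (t, s)).hasFDerivAt
  exact d.comp_hasDerivAt (x := s) (f := fun s' => (t, s')) ((hasDerivAt_const _ _).prodMk (hasDerivAt_id s))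

lemma hasDeriv_t (hv : ContDiff ℝ (⊤ : ℕ∞) (Function.uncurry v)) (t s : ℝ) :
    HasDerivAt (fun t' => v t' s) (pd_t v t s) t := (pd_t_eq hv t s).differentiableAt.hasDerivAt

lemma hasDeriv_s (hv : ContDiff ℝ (⊤ : ℕ∞) (Function.uncurry v)) (t s : ℝ) :
    HasDerivAt (fun s' => v t s') (pd_s v t s) s := (pd_s_eq hv t s).differentiableAt.hasDerivAt

lemma pd_t_smooth (hv : ContDiff ℝ (⊤ : ℕ∞) (Function.uncurry v)) :
    ContDiff ℝ (⊤ : ℕ∞) (Function.uncurry (pd_t v)) := by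
  have : Function.uncurry (pd_t v) = fun p => fderiv ℝ (Function.uncurry v) p (1, 0) := by
    funext ⟨t, s⟩
    exact (pd_t_eq hv t s).deriv
  rw [this]
  exact (hv.fderiv_right (m := (⊤ : ℕ∞)) (by simp)).clm_apply contDiff_const

lemma pd_s_smooth (hv : ContDiff ℝ (⊤ : ℕ∞) (Function.uncurry v)) :
    ContDiff ℝ (⊤ : ℕ∞) (Function.uncurry (pd_s v)) := by
  have : Function.uncurry (pd_s v) = fun p => fderiv ℝ (Function.uncurry v) p (0, 1) := by
    funext ⟨t, s⟩
    exact (pd_s_eq hv t s).deriv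
  rw [this]
  exact (hv.fderiv_right (m := (⊤ : ℕ∞)) (by simp)).clm_apply contDiff_const

lemma pd_comm (hv : ContDiff ℝ (⊤ : ℕ∞) (Function.uncurry v)) (t s : ℝ) :
    pd_t (pd_s v) t s = pd_s (pd_t v) t s := by
  have e1 : Function.uncurry (pd_t v) = fun p => fderiv ℝ (Function.uncurry v) p (1, 0) := by
    funext ⟨t, s⟩
    exact (pd_t_eq hv t s).deriv
  have e2 : Function.uncurry (pd_s v) = fun p => fderiv ℝ (Function.uncurry v) p (0, 1) := by
    funext ⟨t, s⟩
    exact (pd_s_eq hv t s).deriv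
  have hd : DifferentiableAt ℝ (fderiv ℝ (Function.uncurry v)) (t, s) :=
    (hv.fderiv_right (m := (⊤ : ℕ∞)) (by simp)).differentiable (by norm_num) _
  have a1 : pd_t (pd_s v) t s = fderiv ℝ (fderiv ℝ (Function.uncurry v)) (t, s) (1, 0) (0, 1) := by
    have := (pd_t_eq (pd_s_smooth hv) t s).deriv
    rw [e2, fderiv_clm_apply hd (differentiableAt_const _)] at this
    simpa [pd_t] using this
  have a2 : pd_s (pd_t v) t s = fderiv ℝ (fderiv ℝ (Function.uncurry v)) (t, s) (0, 1) (1, 0) := by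
    have := (pd_s_eq (pd_t_smooth hv) t s).deriv
    rw [e1, fderiv_clm_apply hd (differentiableAt_const _)] at this
    simpa [pd_s] using this
  rw [a1, a2]
  have := (hv.contDiffAt (x := (t, s))).isSymmSndFDerivAt (by simp; exact WithTop.coe_le_coe.2 le_top)
  exact this _ _

end smooth
end

section
section fields
variable {M : ℝ} {r : ℝ → ℝ} {φ : ℝ → ℝ → ℝ}

def uF (r : ℝ → ℝ) (φ : ℝ → ℝ → ℝ) : ℝ → ℝ → ℝ := fun t s => r s * φ t s
def wF (r : ℝ → ℝ) (φ : ℝ → ℝ → ℝ) : ℝ → ℝ → ℝ := Svf (uF r φ)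

def Vf (M : ℝ) (r : ℝ → ℝ) (s : ℝ) : ℝ := VC (aM M) (muS M r s) (sg M r s)
def Wf (M : ℝ) (r : ℝ → ℝ) (s : ℝ) : ℝ := WC (aM M) (muS M r s) (sg M r s) s
def ff (M : ℝ) (r : ℝ → ℝ) (s : ℝ) : ℝ := fC (muS M r s) (sg M r s)
def hf (M : ℝ) (r : ℝ → ℝ) (s : ℝ) : ℝ := hC (aM M) (muS M r s) (sg M r s)
def kf (M : ℝ) (r : ℝ → ℝ) (s : ℝ) : ℝ := kC (aM M) (muS M r s) (sg M r s)

lemma Vf_contDiff (hM : 0 < M) (hr : IsTortoise M r) : ContDiff ℝ (⊤ : ℕ∞) (Vf M r) := by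
  have h1 := mu_contDiff hM hr
  have h2 := sg_contDiff hM hr
  unfold Vf VC; fun_prop
lemma ff_contDiff (hM : 0 < M) (hr : IsTortoise M r) : ContDiff ℝ (⊤ : ℕ∞) (ff M r) := by
  have h1 := mu_contDiff hM hr
  have h2 := sg_contDiff hM hr
  unfold ff fC; fun_prop
lemma hf_contDiff (hM : 0 < M) (hr : IsTortoise M r) : ContDiff ℝ (⊤ : ℕ∞) (hf M r) := by
  have h1 := mu_contDiff hM hr
  have h2 := sg_contDiff hM hr
  unfold hf hC; fun_prop
lemma kf_contDiff (hM : 0 < M) (hr : IsTortoise M r) : ContDiff ℝ (⊤ : ℕ∞) (kf M r) := by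
  have h1 := mu_contDiff hM hr
  have h2 := sg_contDiff hM hr
  unfold kf kC; fun_prop

lemma Vf_deriv (hM : 0 < M) (hr : IsTortoise M r) (s : ℝ) :
    HasDerivAt (Vf M r) (VCD (aM M) (muS M r s) (sg M r s)) s := by
  have h1 := hasDeriv_mu hM hr s
  have h2 := hasDeriv_sg hM hr s
  have e := sg_sq hM hr s
  refine (((h1.fun_pow 3).const_mul (aM M ^ 2)).mul (h2.fun_pow 2)).congr_deriv ?_
  unfold VCD
  push_cast
  simp only [Nat.add_one_sub_one, pow_one]
  linear_combination (-3 * aM M ^ 3 * muS M r s ^ 4 * sg M r s ^ 2) * e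

lemma ff_deriv (hM : 0 < M) (hr : IsTortoise M r) (s : ℝ) :
    HasDerivAt (ff M r) (fCD (aM M) (muS M r s) (sg M r s)) s := by
  have h1 := hasDeriv_mu hM hr s
  have h2 := hasDeriv_sg hM hr s
  refine (((h1.div_const 4).const_sub 1).sub ((h2.const_sub 5).mul (h1.fun_pow 2))).congr_deriv ?_
  unfold fCD
  push_cast
  ring

lemma hf_deriv (hM : 0 < M) (hr : IsTortoise M r) (s : ℝ) :
    HasDerivAt (hf M r) (hCD (aM M) (muS M r s) (sg M r s)) s := by
  have h1 := hasDeriv_mu hM hr s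
  have h2 := hasDeriv_sg hM hr s
  have e := sg_sq hM hr s
  refine ((((h2.const_sub 5).const_mul (aM M)).mul (h1.fun_pow 3)).mul (h2.fun_pow 2)).congr_deriv ?_
  unfold hCD
  simp only [Nat.add_one_sub_one, pow_one, Pi.mul_apply]
  push_cast
  generalize muS M r s = m at *
  generalize sg M r s = σ at *
  linear_combination ((-(1/2) * aM M ^ 2 * m ^ 5 * σ - 3 * aM M ^ 2 * (5 - σ) * m ^ 4 * σ ^ 2)
     - (-(1/2) * aM M ^ 2 * m ^ 5 * σ) ) * e

lemma kf_deriv (hM : 0 < M) (hr : IsTortoise M r) (s : ℝ) :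
    HasDerivAt (kf M r) (kCD (aM M) (muS M r s) (sg M r s)) s := by
  have h1 := hasDeriv_mu hM hr s
  have h2 := hasDeriv_sg hM hr s
  have e := sg_sq hM hr s
  refine ((((h1.fun_pow 3).const_mul (aM M ^ 2)).mul (h2.fun_pow 2)).mul
    (((h1.div_const 2).const_sub (1/4)).sub ((h1.fun_pow 2).const_mul (3/2)))).congr_deriv ?_
  unfold kCD
  simp only [Nat.add_one_sub_one, pow_one, Pi.mul_apply, Pi.sub_apply]
  push_cast
  generalize muS M r s = m at *
  generalize sg M r s = σ at *
  linear_combination (-3 * aM M ^ 3 * m ^ 4 * σ ^ 2 * (1 / 4 - m / 2 - 3 / 2 * m ^ 2)) * e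

lemma Wf_eq (s : ℝ) : Wf M r s = 2 * Vf M r s + s * VCD (aM M) (muS M r s) (sg M r s) := by
  unfold Wf Vf WC VC VCD; ring

lemma uF_smooth (hM : 0 < M) (hr : IsTortoise M r) (hφ : ContDiff ℝ (⊤ : ℕ∞) (Function.uncurry φ)) :
    ContDiff ℝ (⊤ : ℕ∞) (Function.uncurry (uF r φ)) := by
  have : Function.uncurry (uF r φ) = fun p => r p.2 * Function.uncurry φ p := by
    funext ⟨t, s⟩; rfl
  rw [this]
  exact ((r_contDiff hM hr).comp contDiff_snd).mul hφ

lemma Svf_smooth {v : ℝ → ℝ → ℝ} (hv : ContDiff ℝ (⊤ : ℕ∞) (Function.uncurry v)) :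
    ContDiff ℝ (⊤ : ℕ∞) (Function.uncurry (Svf v)) := by
  have : Function.uncurry (Svf v) = fun p => p.1 * Function.uncurry (pd_t v) p
      + p.2 * Function.uncurry (pd_s v) p := by
    funext ⟨t, s⟩; rfl
  rw [this]
  exact (contDiff_fst.mul (pd_t_smooth hv)).add (contDiff_snd.mul (pd_s_smooth hv))

/-- derivatives of `S v` -/
lemma Svf_t {v : ℝ → ℝ → ℝ} (hv : ContDiff ℝ (⊤ : ℕ∞) (Function.uncurry v)) (t s : ℝ) :
    pd_t (Svf v) t s = pd_t v t s + t * pd_t (pd_t v) t s + s * pd_s (pd_t v) t s := by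
  have h1 := hasDeriv_t (pd_t_smooth hv) t s
  have h2 := hasDeriv_t (pd_s_smooth hv) t s
  have := (((hasDerivAt_id t).mul h1).add (h2.const_mul s)).deriv
  rw [← pd_comm hv]
  refine this.trans ?_
  simp

lemma Svf_s {v : ℝ → ℝ → ℝ} (hv : ContDiff ℝ (⊤ : ℕ∞) (Function.uncurry v)) (t s : ℝ) :
    pd_s (Svf v) t s = t * pd_s (pd_t v) t s + pd_s v t s + s * pd_s (pd_s v) t s := by
  have h1 := hasDeriv_s (pd_t_smooth hv) t s
  have h2 := hasDeriv_s (pd_s_smooth hv) t s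
  have := ((h1.const_mul t).add ((hasDerivAt_id s).mul h2)).deriv
  refine this.trans ?_
  simp; ring

lemma uF_t (hφ : ContDiff ℝ (⊤ : ℕ∞) (Function.uncurry φ)) (t s : ℝ) :
    pd_t (uF r φ) t s = r s * pd_t φ t s := 
  ((hasDeriv_t hφ t s).const_mul (r s)).deriv

lemma uF_s (hM : 0 < M) (hr : IsTortoise M r) (hφ : ContDiff ℝ (⊤ : ℕ∞) (Function.uncurry φ)) (t s : ℝ) :
    pd_s (uF r φ) t s = sg M r s ^ 2 * φ t s + r s * pd_s φ t s := 
  ((hasDeriv_r hM hr s).mul (hasDeriv_s hφ t s)).deriv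

lemma r_mul_V (hM : 0 < M) (hr : IsTortoise M r) (s : ℝ) :
    r s * Vf M r s = aM M * muS M r s ^ 2 * sg M r s ^ 2 := by
  have e := r_mul hM hr s
  unfold Vf VC
  linear_combination (aM M * muS M r s ^ 2 * sg M r s ^ 2) * e

lemma u_eq (hM : 0 < M) (hr : IsTortoise M r) (hφ : IsWaveSol r φ) (t s : ℝ) :
    pd_t (pd_t (uF r φ)) t s = pd_s (pd_s (uF r φ)) t s - Vf M r s * uF r φ t s := by
  have hs := hφ.1
  have w := hφ.2.1 t s
  have hrp := r_pos hM hr s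
  have d1 := (((hasDeriv_r hM hr s).fun_pow 2).mul (hasDeriv_s (pd_s_smooth hs) t s)).deriv
  have e1 : pd_t (uF r φ) = fun t s => r s * pd_t φ t s := by funext t s; exact uF_t hs t s
  have e2 : pd_s (uF r φ) = fun t s => sg M r s ^ 2 * φ t s + r s * pd_s φ t s := by
    funext t s; exact uF_s hM hr hs t s
  have a1 : pd_t (pd_t (uF r φ)) t s = r s * pd_t (pd_t φ) t s := by
    rw [e1]; exact ((hasDeriv_t (pd_t_smooth hs) t s).const_mul (r s)).deriv
  have a2 : pd_s (pd_s (uF r φ)) t s = (2 * sg M r s * (1 / 2 * aM M * muS M r s ^ 2 * sg M r s)) * φ t s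
      + sg M r s ^ 2 * pd_s φ t s + (sg M r s ^ 2 * pd_s φ t s + r s * pd_s (pd_s φ) t s) := by
    rw [e2]
    have := ((((hasDeriv_sg hM hr s).fun_pow 2).mul (hasDeriv_s hs t s)).add
      ((hasDeriv_r hM hr s).mul (hasDeriv_s (pd_s_smooth hs) t s))).deriv
    refine this.trans ?_
    push_cast
    ring
  have w2 : r s * pd_t (pd_t φ) t s = 2 * sg M r s ^ 2 * pd_s φ t s + r s * pd_s (pd_s φ) t s := by
    rw [w]
    have d2 : deriv (fun x => (r x) ^ 2 * pd_s φ t x) s = _ := d1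
    rw [d2]
    push_cast
    field_simp
    try ring
  rw [a1, a2, w2]
  have rv := r_mul_V hM hr s
  unfold uF
  linear_combination φ t s * rv

lemma w_eq (hM : 0 < M) (hr : IsTortoise M r) (hφ : IsWaveSol r φ) (t s : ℝ) :
    pd_t (pd_t (wF r φ)) t s = pd_s (pd_s (wF r φ)) t s - Vf M r s * wF r φ t s
      + (-(Wf M r s * uF r φ t s)) := by
  have hu := uF_smooth hM hr hφ.1
  have hu_t := pd_t_smooth hu
  have hu_s := pd_s_smooth hu
  have eq := u_eq hM hr hφ
  have e1 : pd_t (wF r φ) = fun t s => pd_t (uF r φ) t s + t * pd_t (pd_t (uF r φ)) t s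
      + s * pd_s (pd_t (uF r φ)) t s := by funext t s; exact Svf_t hu t s
  have e2 : pd_s (wF r φ) = fun t s => t * pd_s (pd_t (uF r φ)) t s + pd_s (uF r φ) t s
      + s * pd_s (pd_s (uF r φ)) t s := by funext t s; exact Svf_s hu t s
  have a1 : pd_t (pd_t (wF r φ)) t s = 2 * pd_t (pd_t (uF r φ)) t s
      + t * pd_t (pd_t (pd_t (uF r φ))) t s + s * pd_t (pd_s (pd_t (uF r φ))) t s := by
    rw [e1]
    have := (((hasDeriv_t hu_t t s).add ((hasDerivAt_id t).mul (hasDeriv_t (pd_t_smooth hu_t) t s))).add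
      ((hasDeriv_t (pd_s_smooth hu_t) t s).const_mul s)).deriv
    refine this.trans ?_
    simp; ring
  have a2 : pd_s (pd_s (wF r φ)) t s = t * pd_s (pd_s (pd_t (uF r φ))) t s + 2 * pd_s (pd_s (uF r φ)) t s
      + s * pd_s (pd_s (pd_s (uF r φ))) t s := by
    rw [e2]
    have := ((((hasDeriv_s (pd_s_smooth hu_t) t s).const_mul t).add (hasDeriv_s hu_s t s)).add
      ((hasDerivAt_id s).mul (hasDeriv_s (pd_s_smooth hu_s) t s))).deriv
    refine this.trans ?_
    simp; ring
  have efun : pd_t (pd_t (uF r φ)) = fun t s => pd_s (pd_s (uF r φ)) t s - Vf M r s * uF r φ t s := by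
    funext t s; exact eq t s
  have b1 : pd_t (pd_t (pd_t (uF r φ))) t s = pd_s (pd_s (pd_t (uF r φ))) t s - Vf M r s * pd_t (uF r φ) t s := by
    conv_lhs => rw [efun]
    have := ((hasDeriv_t (pd_s_smooth hu_s) t s).sub ((hasDeriv_t hu t s).const_mul (Vf M r s))).deriv
    refine this.trans ?_
    rw [pd_comm hu_s]
    have : pd_t (pd_s (uF r φ)) = pd_s (pd_t (uF r φ)) := by funext t s; exact pd_comm hu t s
    rw [this]
  have b2 : pd_t (pd_s (pd_t (uF r φ))) t s = pd_s (pd_s (pd_s (uF r φ))) t s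
      - VCD (aM M) (muS M r s) (sg M r s) * uF r φ t s - Vf M r s * pd_s (uF r φ) t s := by
    rw [pd_comm hu_t]
    rw [efun]
    have := ((hasDeriv_s (pd_s_smooth hu_s) t s).sub ((Vf_deriv hM hr s).mul (hasDeriv_s hu t s))).deriv
    refine this.trans ?_
    ring
  rw [a1, a2, b1, b2, eq, Wf_eq]
  unfold wF Svf
  ring

lemma vanish_t {v : ℝ → ℝ → ℝ} {S₀ : ℝ} (h : ∀ t s, S₀ + |t - 1| < s → v t s = 0) :
    ∀ t s, S₀ + |t - 1| < s → pd_t v t s = 0 := by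
  intro t s hs
  have : (fun t' => v t' s) =ᶠ[nhds t] fun _ => (0:ℝ) := by
    have hc : Continuous fun t' : ℝ => S₀ + |t' - 1| := by fun_prop
    filter_upwards [(isOpen_lt hc continuous_const).mem_nhds hs] with z hz
    exact h z s hz
  unfold pd_t
  rw [this.deriv_eq]; simp

lemma vanish_s {v : ℝ → ℝ → ℝ} {S₀ : ℝ} (h : ∀ t s, S₀ + |t - 1| < s → v t s = 0) :
    ∀ t s, S₀ + |t - 1| < s → pd_s v t s = 0 := by
  intro t s hs
  have : (fun s' => v t s') =ᶠ[nhds s] fun _ => (0:ℝ) := by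
    filter_upwards [(isOpen_lt continuous_const continuous_id).mem_nhds hs] with z hz
    exact h t z hz
  unfold pd_s
  rw [this.deriv_eq]; simp

end fields
end

section
lemma dens_contDiffOn {δ c : ℝ} {U : Set (ℝ × ℝ)} {τ s V f h X v vt vs : ℝ × ℝ → ℝ}
    (hτ : ContDiffOn ℝ 1 τ U) (hτ0 : ∀ p ∈ U, τ p ≠ 0) (hs : ContDiffOn ℝ 1 s U)
    (hV : ContDiffOn ℝ 1 V U) (hf : ContDiffOn ℝ 1 f U) (hh : ContDiffOn ℝ 1 h U)
    (hX : ContDiffOn ℝ 1 X U) (hv : ContDiffOn ℝ 1 v U) (hvt : ContDiffOn ℝ 1 vt U)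
    (hvs : ContDiffOn ℝ 1 vs U) :
    ContDiffOn ℝ 1 (fun p => dens δ c (τ p) (s p) (V p) (f p) (h p) (X p) (v p) (vt p) (vs p)) U := by
  unfold dens
  refine (hτ.rpow_const_of_ne hτ0).mul ?_
  unfold eKd m0d
  fun_prop

lemma flux_contDiffOn {δ c : ℝ} {U : Set (ℝ × ℝ)} {τ s V f h k X v vt vs : ℝ × ℝ → ℝ}
    (hτ : ContDiffOn ℝ 1 τ U) (hτ0 : ∀ p ∈ U, τ p ≠ 0) (hs : ContDiffOn ℝ 1 s U)
    (hV : ContDiffOn ℝ 1 V U) (hf : ContDiffOn ℝ 1 f U) (hh : ContDiffOn ℝ 1 h U)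
    (hk : ContDiffOn ℝ 1 k U)
    (hX : ContDiffOn ℝ 1 X U) (hv : ContDiffOn ℝ 1 v U) (hvt : ContDiffOn ℝ 1 vt U)
    (hvs : ContDiffOn ℝ 1 vs U) :
    ContDiffOn ℝ 1 (fun p => flux δ c (τ p) (s p) (V p) (f p) (h p) (k p) (X p) (v p) (vt p) (vs p)) U := by
  unfold flux
  refine (hτ.rpow_const_of_ne hτ0).mul ?_
  unfold jKd j0d
  fun_prop

section mono
variable {M : ℝ} {r : ℝ → ℝ} {φ : ℝ → ℝ → ℝ}

/-- density for a field `v`, in coordinates -/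
def densF (M : ℝ) (r : ℝ → ℝ) (χ : ℝ → ℝ) (δ c T : ℝ) (v : ℝ → ℝ → ℝ) (p : ℝ × ℝ) : ℝ :=
  dens δ c (p.1 + T) p.2 (Vf M r p.2) (ff M r p.2) (hf M r p.2) (χ (p.2 / (p.1 + T)))
    (v p.1 p.2) (pd_t v p.1 p.2) (pd_s v p.1 p.2)
def fluxF (M : ℝ) (r : ℝ → ℝ) (χ : ℝ → ℝ) (δ c T : ℝ) (v : ℝ → ℝ → ℝ) (p : ℝ × ℝ) : ℝ :=
  flux δ c (p.1 + T) p.2 (Vf M r p.2) (ff M r p.2) (hf M r p.2) (kf M r p.2) (χ (p.2 / (p.1 + T)))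
    (v p.1 p.2) (pd_t v p.1 p.2) (pd_s v p.1 p.2)
def densTF (M : ℝ) (r : ℝ → ℝ) (χ : ℝ → ℝ) (δ c T : ℝ) (v : ℝ → ℝ → ℝ) (t s : ℝ) : ℝ :=
  densT δ c (t + T) s (Vf M r s) (ff M r s) (hf M r s) (χ (s / (t + T)))
    (-(deriv χ (s / (t + T)) * (s / (t + T) ^ 2)))
    (v t s) (pd_t v t s) (pd_s v t s) (pd_t (pd_t v) t s) (pd_s (pd_t v) t s)
def fluxSF (M : ℝ) (r : ℝ → ℝ) (χ : ℝ → ℝ) (δ c T : ℝ) (v : ℝ → ℝ → ℝ) (t s : ℝ) : ℝ :=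
  fluxS δ c (t + T) s (Vf M r s) (VCD (aM M) (muS M r s) (sg M r s)) (ff M r s)
    (fCD (aM M) (muS M r s) (sg M r s)) (hf M r s) (hCD (aM M) (muS M r s) (sg M r s)) (kf M r s)
    (kCD (aM M) (muS M r s) (sg M r s)) (χ (s / (t + T))) (deriv χ (s / (t + T)) / (t + T))
    (v t s) (pd_t v t s) (pd_s v t s) (pd_s (pd_t v) t s) (pd_s (pd_s v) t s)

lemma densF_contDiffOn (hM : 0 < M) (hr : IsTortoise M r) {χ : ℝ → ℝ} (hχ : ContDiff ℝ (⊤ : ℕ∞) χ)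
    {δ c T : ℝ} (hT : 0 ≤ T) {v : ℝ → ℝ → ℝ} (hv : ContDiff ℝ (⊤ : ℕ∞) (Function.uncurry v)) :
    ContDiffOn ℝ 1 (densF M r χ δ c T v) {p | 0 < p.1} ∧
    ContDiffOn ℝ 1 (fluxF M r χ δ c T v) {p | 0 < p.1} := by
  have l : (1 : WithTop ℕ∞) ≤ ((⊤ : ℕ∞) : WithTop ℕ∞) := by
    exact WithTop.coe_le_coe.2 le_top
  have hτ : ContDiffOn ℝ 1 (fun p : ℝ × ℝ => p.1 + T) {p | 0 < p.1} := by fun_prop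
  have hτ0 : ∀ p ∈ {p : ℝ × ℝ | 0 < p.1}, p.1 + T ≠ 0 := fun p hp => by
    have : 0 < p.1 := hp
    positivity
  have hV : ContDiffOn ℝ 1 (fun p : ℝ × ℝ => Vf M r p.2) {p | 0 < p.1} :=
    (((Vf_contDiff hM hr).of_le l).comp contDiff_snd).contDiffOn
  have hff : ContDiffOn ℝ 1 (fun p : ℝ × ℝ => ff M r p.2) {p | 0 < p.1} :=
    (((ff_contDiff hM hr).of_le l).comp contDiff_snd).contDiffOn
  have hh : ContDiffOn ℝ 1 (fun p : ℝ × ℝ => hf M r p.2) {p | 0 < p.1} :=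
    (((hf_contDiff hM hr).of_le l).comp contDiff_snd).contDiffOn
  have hk : ContDiffOn ℝ 1 (fun p : ℝ × ℝ => kf M r p.2) {p | 0 < p.1} :=
    (((kf_contDiff hM hr).of_le l).comp contDiff_snd).contDiffOn
  have hX : ContDiffOn ℝ 1 (fun p : ℝ × ℝ => χ (p.2 / (p.1 + T))) {p | 0 < p.1} :=
    (hχ.of_le l).comp_contDiffOn (contDiff_snd.contDiffOn.div hτ hτ0)
  have h1 : ContDiffOn ℝ 1 (fun p : ℝ × ℝ => v p.1 p.2) {p | 0 < p.1} := (hv.of_le l).contDiffOn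
  have h2 : ContDiffOn ℝ 1 (fun p : ℝ × ℝ => pd_t v p.1 p.2) {p | 0 < p.1} :=
    ((pd_t_smooth hv).of_le l).contDiffOn
  have h3 : ContDiffOn ℝ 1 (fun p : ℝ × ℝ => pd_s v p.1 p.2) {p | 0 < p.1} :=
    ((pd_s_smooth hv).of_le l).contDiffOn
  exact ⟨dens_contDiffOn hτ hτ0 contDiff_snd.contDiffOn hV hff hh hX h1 h2 h3,
    flux_contDiffOn hτ hτ0 contDiff_snd.contDiffOn hV hff hh hk hX h1 h2 h3⟩

lemma densF_deriv {χ : ℝ → ℝ} (hχ : ContDiff ℝ (⊤ : ℕ∞) χ)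
    {δ c T : ℝ} (hT : 0 ≤ T) {v : ℝ → ℝ → ℝ} (hv : ContDiff ℝ (⊤ : ℕ∞) (Function.uncurry v))
    (t s : ℝ) (ht : 0 < t) :
    HasDerivAt (fun t' => densF M r χ δ c T v (t', s)) (densTF M r χ δ c T v t s) t := by
  have h3 := hasDeriv_t (pd_s_smooth hv) t s
  rw [pd_comm hv] at h3
  have := hasDeriv_dens (δ := δ) (c := c) (T := T) (s := s) (V := Vf M r s) (f := ff M r s) (h := hf M r s)
    (χ := χ) (t := t) (v := fun t' => v t' s) (vt := fun t' => pd_t v t' s) (vs := fun t' => pd_s v t' s)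
    (by positivity) (hχ.differentiable (by norm_num)) (hasDeriv_t hv t s) (hasDeriv_t (pd_t_smooth hv) t s) h3
  exact this

lemma fluxF_deriv (hM : 0 < M) (hr : IsTortoise M r) {χ : ℝ → ℝ} (hχ : ContDiff ℝ (⊤ : ℕ∞) χ)
    {δ c T : ℝ} (hT : 0 ≤ T) {v : ℝ → ℝ → ℝ} (hv : ContDiff ℝ (⊤ : ℕ∞) (Function.uncurry v))
    (t s : ℝ) (ht : 0 < t) :
    HasDerivAt (fun s' => fluxF M r χ δ c T v (t, s')) (fluxSF M r χ δ c T v t s) s := by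
  have := hasDeriv_flux (δ := δ) (c := c) (τ := t + T) (χ := χ) (t := t) (v := fun s' => v t s') (vt := fun s' => pd_t v t s') (vs := fun s' => pd_s v t s')
    (by positivity) (hχ.differentiable (by norm_num))
    (Vf_deriv hM hr s) (ff_deriv hM hr s) (hf_deriv hM hr s) (kf_deriv hM hr s)
    (hasDeriv_s hv t s) (hasDeriv_s (pd_t_smooth hv) t s) (hasDeriv_s (pd_s_smooth hv) t s)
  exact this

lemma mono_le (T : ℝ) {δ c t s C R B D : ℝ} {χ : ℝ → ℝ} (hM : 0 < M) (hr : IsTortoise M r)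
    (hφ : IsWaveSol r φ) {p q : ℝ} (hpe : p = pC (aM M) (muS M r s) (sg M r s))
    (hqe : q = qC (aM M) (muS M r s) (sg M r s))
    (H : Coef C R (t + T) s (Vf M r s) (Wf M r s) (ff M r s) (hf M r s) (kf M r s) (χ (s / (t + T)))
      (-(deriv χ (s / (t + T)) * (s / (t + T) ^ 2))) (deriv χ (s / (t + T)) / (t + T)) p q)
    (hδ : 0 < δ) (hδ1 : δ < 1) (hc : c * (160 * C ^ 2) = δ)
    (hD : D = 8 * C / c + 100 * C / δ + c * (C ^ 3 + C))
    (hB : B = 2 * D / c + 2 * D / δ) (hR : 4 * R ≤ t + T) (hT : 2 * C ≤ c * (t + T)) :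
    densTF M r χ δ c T (wF r φ) t s + B * densTF M r χ δ c T (uF r φ) t s ≤
      fluxSF M r χ δ c T (wF r φ) t s + B * fluxSF M r χ δ c T (uF r φ) t s := by
  have i1 := dens_identity (δ := δ) (c := c) (τ := t + T) (f' := fCD (aM M) (muS M r s) (sg M r s))
    (h' := hCD (aM M) (muS M r s) (sg M r s)) (k' := kCD (aM M) (muS M r s) (sg M r s))
    (f := ff M r s) (h := hf M r s) (k := kf M r s) (X := χ (s / (t + T)))
    (Xt := -(deriv χ (s / (t + T)) * (s / (t + T) ^ 2))) (Xs := deriv χ (s / (t + T)) / (t + T))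
    (vt := pd_t (wF r φ) t s) (vs := pd_s (wF r φ) t s) (vts := pd_s (pd_t (wF r φ)) t s)
    (Wf_eq s) (w_eq hM hr hφ t s)
  have i2 := dens_identity (δ := δ) (c := c) (τ := t + T) (f' := fCD (aM M) (muS M r s) (sg M r s))
    (h' := hCD (aM M) (muS M r s) (sg M r s)) (k' := kCD (aM M) (muS M r s) (sg M r s))
    (f := ff M r s) (h := hf M r s) (k := kf M r s) (X := χ (s / (t + T)))
    (Xt := -(deriv χ (s / (t + T)) * (s / (t + T) ^ 2))) (Xs := deriv χ (s / (t + T)) / (t + T))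
    (vt := pd_t (uF r φ) t s) (vs := pd_s (uF r φ) t s) (vts := pd_s (pd_t (uF r φ)) t s) (F := 0)
    (v := uF r φ t s) (vtt := pd_t (pd_t (uF r φ)) t s) (vss := pd_s (pd_s (uF r φ)) t s) (V := Vf M r s)
    (Wf_eq s) (by rw [u_eq hM hr hφ]; ring)
  have Rt := R_total H hδ hδ1 hc hD hB hR hT (wF r φ t s) (pd_t (wF r φ) t s) (pd_s (wF r φ) t s)
    (QC (fCD (aM M) (muS M r s) (sg M r s)) (hf M r s) (Vf M r s) (VCD (aM M) (muS M r s) (sg M r s)) (hCD (aM M) (muS M r s) (sg M r s)) (kf M r s) (kCD (aM M) (muS M r s) (sg M r s)) (ff M r s) (wF r φ t s) (pd_t (wF r φ) t s) (pd_s (wF r φ) t s))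
    (uF r φ t s) (pd_t (uF r φ) t s) (pd_s (uF r φ) t s)
    (QC (fCD (aM M) (muS M r s) (sg M r s)) (hf M r s) (Vf M r s) (VCD (aM M) (muS M r s) (sg M r s)) (hCD (aM M) (muS M r s) (sg M r s)) (kf M r s) (kCD (aM M) (muS M r s) (sg M r s)) (ff M r s) (uF r φ t s) (pd_t (uF r φ) t s) (pd_s (uF r φ) t s))
    (by rw [hpe, hqe]
        exact Q_lower (aM_pos hM) (sg_pos hM hr s).le (sg_lt_one hM hr s).le (mu_eq hM hr s) _ _ _)
    (by rw [hpe, hqe]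
        exact Q_lower (aM_pos hM) (sg_pos hM hr s).le (sg_lt_one hM hr s).le (mu_eq hM hr s) _ _ _)
  have hpos : 0 < (t + T) ^ (-δ) := Real.rpow_pos_of_pos H.hτ _
  have := mul_nonpos_of_nonneg_of_nonpos hpos.le Rt
  rw [mul_add, mul_left_comm] at this
  rw [← i1, ← i2] at this
  unfold densTF fluxSF
  linarith

end mono
end

section
section main
variable {M : ℝ} {r : ℝ → ℝ} {φ : ℝ → ℝ → ℝ}

lemma coefF (hM : 0 < M) (hr : IsTortoise M r) {χ : ℝ → ℝ} {K : ℝ} (hK0 : 0 ≤ K)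
    (hχ0 : ∀ y, 0 ≤ χ y) (hχ1 : ∀ y, χ y ≤ 1) (hin : ∀ y, |y| ≤ 1 / 4 → χ y = 1)
    (hout : ∀ y, 1 / 2 < |y| → χ y = 0 ∧ deriv χ y = 0) (hK : ∀ y, |deriv χ y| ≤ K)
    {τ : ℝ} (hτ : 0 < τ) (s : ℝ) :
    Coef (10 ^ 8 * (1 + M) + K) (30 * M) τ s (Vf M r s) (Wf M r s) (ff M r s) (hf M r s) (kf M r s)
      (χ (s / τ)) (-(deriv χ (s / τ) * (s / τ ^ 2))) (deriv χ (s / τ) / τ)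
      (pC (aM M) (muS M r s) (sg M r s)) (qC (aM M) (muS M r s) (sg M r s)) := by
  obtain ⟨a1, a2, a3, a4, a5, a6, a7, a8, a9, a10, a11⟩ :=
    (coef_bounds hM hr s).mono (le_add_of_nonneg_right hK0)
  have habs : |s / τ| = |s| / τ := by rw [abs_div, abs_of_pos hτ]
  have hl : K ≤ 10 ^ 8 * (1 + M) + K := le_add_of_nonneg_left (by positivity)
  refine ⟨?_, a1, hτ, a2, a3, a4, a5, a6, a7, a8, a9, a10, a11, hχ0 _, hχ1 _, ?_, ?_, ?_, ?_⟩
  · nlinarith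
  · intro h; apply hin; rw [habs, div_le_iff₀ hτ]; linarith
  · intro h
    obtain ⟨e1, e2⟩ := hout (s / τ) (by rw [habs, lt_div_iff₀ hτ]; linarith)
    rw [e1, e2]; simp
  · refine le_trans ?_ hl
    have : τ * |-(deriv χ (s / τ) * (s / τ ^ 2))| = |deriv χ (s / τ)| * |s / τ| := by
      rw [abs_neg, abs_mul, abs_div, abs_div, abs_of_pos hτ, abs_of_pos (by positivity : 0 < τ ^ 2)]
      field_simp
    rw [this]
    by_cases h : 1 / 2 < |s / τ|
    · rw [(hout _ h).2]; simpa using hK0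
    · have := hK (s / τ)
      have := abs_nonneg (deriv χ (s / τ))
      have := not_lt.1 h
      nlinarith [abs_nonneg (s / τ)]
  · refine le_trans ?_ hl
    rw [abs_div, abs_of_pos hτ, mul_div_cancel₀ _ hτ.ne']
    exact hK _

/-- the conformal energy density of `v` -/
def eKF (M : ℝ) (r : ℝ → ℝ) (T : ℝ) (v : ℝ → ℝ → ℝ) (t s : ℝ) : ℝ :=
  eKd (t + T) s (Vf M r s) (v t s) (pd_t v t s) (pd_s v t s)

lemma Vf_nonneg (hM : 0 < M) (hr : IsTortoise M r) (s : ℝ) : 0 ≤ Vf M r s := (coef_bounds hM hr s).hV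

lemma eKF_nonneg (hM : 0 < M) (hr : IsTortoise M r) (T : ℝ) (v : ℝ → ℝ → ℝ) (t s : ℝ) :
    0 ≤ eKF M r T v t s := eKd_nonneg (Vf_nonneg hM hr s)

lemma slice_cont {v : ℝ → ℝ → ℝ} (hv : ContDiff ℝ (⊤ : ℕ∞) (Function.uncurry v)) (t : ℝ) :
    Continuous (fun s => v t s) := 
  hv.continuous.comp (by fun_prop : Continuous fun s : ℝ => (t, s))

lemma eKF_cont (hM : 0 < M) (hr : IsTortoise M r) (T : ℝ) {v : ℝ → ℝ → ℝ}
    (hv : ContDiff ℝ (⊤ : ℕ∞) (Function.uncurry v)) (t : ℝ) : Continuous (eKF M r T v t) := by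
  have h1 := slice_cont hv t
  have h2 := slice_cont (pd_t_smooth hv) t
  have h3 := slice_cont (pd_s_smooth hv) t
  have h4 := (Vf_contDiff hM hr).continuous
  unfold eKF eKd
  fun_prop

lemma densF_zero_left (hM : 0 < M) (hr : IsTortoise M r) {χ : ℝ → ℝ} {δ c T t s : ℝ} {v : ℝ → ℝ → ℝ}
    (hχ : χ (s / (t + T)) = 0) (hτ : 0 < t + T) :
    0 ≤ densF M r χ δ c T v (t, s) + fluxF M r χ δ c T v (t, s) := by
  unfold densF fluxF dens flux
  simp only [hχ, mul_zero, zero_mul, add_zero]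
  rw [← mul_add]
  apply mul_nonneg (Real.rpow_nonneg hτ.le _)
  have hV := Vf_nonneg hM hr s
  generalize Vf M r s = V at *
  generalize v t s = x at *
  generalize pd_t v t s = y at *
  generalize pd_s v t s = z at *
  generalize t + T = τ at *
  have : eKd τ s V x y z + jKd τ s V x y z = 1 / 2 * (τ + s) ^ 2 * (y + z) ^ 2 + 1 / 2 * V * ((τ - s) * x) ^ 2 := by
    unfold eKd jKd; ring
  rw [this]; positivity

lemma densF_zero_right {χ : ℝ → ℝ} {δ c T t s : ℝ} {v : ℝ → ℝ → ℝ}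
    (h1 : v t s = 0) (h2 : pd_t v t s = 0) (h3 : pd_s v t s = 0) :
    densF M r χ δ c T v (t, s) + fluxF M r χ δ c T v (t, s) = 0 := by
  unfold densF fluxF dens flux
  simp only [h1, h2, h3]
  unfold eKd m0d jKd j0d
  simp

lemma energy_main (hM : 0 < M) (hr : IsTortoise M r) {δ : ℝ} (hδ : 0 < δ) (hδ1 : δ < 1) :
    ∃ T B : ℝ, 0 ≤ T ∧ 0 < B ∧ ∀ φ, IsWaveSol r φ → ∀ ts : ℝ, 1 ≤ ts → ∃ a b : ℝ, a ≤ b ∧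
      (ts + T) ^ (-δ) * ∫ s in (-(ts / 2))..(ts / 2),
          (eKF M r T (wF r φ) ts s + B * eKF M r T (uF r φ) ts s) ≤
        3 * ∫ s in a..b, (eKF M r T (wF r φ) 1 s + B * eKF M r T (uF r φ) 1 s) := by
  obtain ⟨χ, K, hK0, hχs, hχ0, hχ1, hin, hout, hK⟩ := exists_cutoff
  set C := 10 ^ 8 * (1 + M) + K with hC
  have hC0 : 0 < C := by positivity
  obtain ⟨c, hc⟩ : ∃ c, c = δ / (160 * C ^ 2) := ⟨_, rfl⟩
  have hc0 : 0 < c := by rw [hc]; positivity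
  have hc' : c * (160 * C ^ 2) = δ := by rw [hc]; field_simp
  obtain ⟨D, hD⟩ : ∃ D, D = 8 * C / c + 100 * C / δ + c * (C ^ 3 + C) := ⟨_, rfl⟩
  have hD0 : 0 < D := by rw [hD]; positivity
  obtain ⟨B, hB⟩ : ∃ B, B = 2 * D / c + 2 * D / δ := ⟨_, rfl⟩
  have hB0 : 0 < B := by rw [hB]; positivity
  obtain ⟨T, hT⟩ : ∃ T, T = 120 * M + 2 * C / c := ⟨_, rfl⟩
  have hT0 : 0 < T := by rw [hT]; positivity
  refine ⟨T, B, hT0.le, hB0, ?_⟩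
  intro φ hφ ts hts
  have hu := uF_smooth hM hr hφ.1
  have hw : ContDiff ℝ (⊤ : ℕ∞) (Function.uncurry (wF r φ)) := Svf_smooth hu
  obtain ⟨S₀, hS⟩ := hφ.2.2
  have zu : ∀ t s, S₀ + |t - 1| < s → uF r φ t s = 0 := fun t s h => by
    unfold uF; rw [hS t s h.le, mul_zero]
  have zut := vanish_t zu
  have zus := vanish_s zu
  have zw : ∀ t s, S₀ + |t - 1| < s → wF r φ t s = 0 := fun t s h => by
    unfold wF Svf; rw [zut t s h, zus t s h]; simp
  have zwt := vanish_t zw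
  have zws := vanish_s zw
  set A := -(2 * ts + T) with hA
  set X := |S₀| + 4 * ts + T + 10 with hX
  have hX0 : 0 ≤ X := by have := abs_nonneg S₀; linarith
  have hco : ∀ t s, 1 ≤ t → Coef C (30 * M) (t + T) s (Vf M r s) (Wf M r s) (ff M r s) (hf M r s) (kf M r s)
      (χ (s / (t + T))) (-(deriv χ (s / (t + T)) * (s / (t + T) ^ 2))) (deriv χ (s / (t + T)) / (t + T))
      (pC (aM M) (muS M r s) (sg M r s)) (qC (aM M) (muS M r s) (sg M r s)) := fun t s ht =>
    coefF hM hr hK0 hχ0 hχ1 hin hout hK (by linarith) s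
  have dw := densF_contDiffOn hM hr hχs (δ := δ) (c := c) hT0.le hw
  have du := densF_contDiffOn hM hr hχs (δ := δ) (c := c) hT0.le hu
  have key := div_lemma (fun p => densF M r χ δ c T (wF r φ) p + B * densF M r χ δ c T (uF r φ) p)
    (fun p => fluxF M r χ δ c T (wF r φ) p + B * fluxF M r χ δ c T (uF r φ) p)
    (dw.1.add (contDiffOn_const.mul du.1)) (dw.2.add (contDiffOn_const.mul du.2))
    (fun t s => densTF M r χ δ c T (wF r φ) t s + B * densTF M r χ δ c T (uF r φ) t s)
    (fun t s => fluxSF M r χ δ c T (wF r φ) t s + B * fluxSF M r χ δ c T (uF r φ) t s)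
    (fun t s ht => (densF_deriv hχs hT0.le hw t s ht).add ((densF_deriv hχs hT0.le hu t s ht).const_mul B))
    (fun t s ht => (fluxF_deriv hM hr hχs hT0.le hw t s ht).add ((fluxF_deriv hM hr hχs hT0.le hu t s ht).const_mul B))
    (t1 := 1) (t2 := ts) (A := A) (X := X) one_pos hts hX0
    (fun t s h1 h2 => by
      refine mono_le T hM hr hφ rfl rfl (hco t s h1) hδ hδ1 hc' hD hB ?_ ?_
      · have : 0 < 2 * C / c := by positivity
        linarith
      · have : c * (2 * C / c) = 2 * C := by field_simp
        have : 0 < c * (t + 120 * M) := by positivity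
        rw [hT]; linarith)
    (fun t h1 h2 => by
      have hτ : 0 < t + T := by linarith
      have hz : χ ((A + t) / (t + T)) = 0 := by
        refine (hout _ ?_).1
        rw [abs_div, abs_of_pos hτ, lt_div_iff₀ hτ, abs_of_neg (by linarith)]
        linarith
      have i1 := densF_zero_left hM hr (δ := δ) (c := c) (v := wF r φ) hz hτ
      have i2 := mul_nonneg hB0.le (densF_zero_left hM hr (δ := δ) (c := c) (v := uF r φ) hz hτ)
      linarith)
    (fun t h1 h2 => by
      have hs : S₀ + |t - 1| < A + t + X := by
        rw [abs_of_nonneg (by linarith)]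
        linarith [le_abs_self S₀]
      have i1 := densF_zero_right (M := M) (r := r) (χ := χ) (δ := δ) (c := c) (T := T) (zw _ _ hs) (zwt _ _ hs) (zws _ _ hs)
      have i2 := densF_zero_right (M := M) (r := r) (χ := χ) (δ := δ) (c := c) (T := T) (zu _ _ hs) (zut _ _ hs) (zus _ _ hs)
      linear_combination i1 + B * i2)
  have ch : ∀ t, ∫ x in (0:ℝ)..X, (fun p => densF M r χ δ c T (wF r φ) p + B * densF M r χ δ c T (uF r φ) p) (t, A + t + x)
      = ∫ s in (A + t)..(A + t + X), (densF M r χ δ c T (wF r φ) (t, s) + B * densF M r χ δ c T (uF r φ) (t, s)) := by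
    intro t
    have := intervalIntegral.integral_comp_add_left (a := 0) (b := X) (fun s => densF M r χ δ c T (wF r φ) (t, s) + B * densF M r χ δ c T (uF r φ) (t, s)) (A + t)
    rw [add_zero] at this
    exact this
  rw [ch, ch] at key
  -- pointwise comparison
  have cmp : ∀ (v : ℝ → ℝ → ℝ) (t s : ℝ), 1 ≤ t →
      (t + T) ^ (-δ) * (1 / 2 * eKF M r T v t s) ≤ densF M r χ δ c T v (t, s) ∧
      densF M r χ δ c T v (t, s) ≤ (t + T) ^ (-δ) * (3 / 2 * eKF M r T v t s) := by
    intro v t s ht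
    have hτ : 0 < t + T := by linarith
    have n := abs_le.1 (N_cmp (hco t s ht) hδ hδ1 hc' (v t s) (pd_t v t s) (pd_s v t s))
    have hp := Real.rpow_nonneg hτ.le (-δ)
    constructor
    · apply mul_le_mul_of_nonneg_left _ hp
      unfold eKF; simp only; linarith [n.1]
    · apply mul_le_mul_of_nonneg_left _ hp
      unfold eKF; simp only; linarith [n.2]
  have cont : ∀ (v : ℝ → ℝ → ℝ) (hv : ContDiff ℝ (⊤ : ℕ∞) (Function.uncurry v)) (t : ℝ), 1 ≤ t →
      Continuous fun s => densF M r χ δ c T v (t, s) := by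
    intro v hv t ht
    have := (densF_contDiffOn hM hr hχs (δ := δ) (c := c) hT0.le hv).1.continuousOn
    exact this.comp_continuous (by fun_prop : Continuous fun s : ℝ => (t, s)) (fun s => by
      show 0 < t; linarith)
  have eKw := eKF_cont hM hr T hw
  have eKu := eKF_cont hM hr T hu
  have cw := cont _ hw
  have cu := cont _ hu
  refine ⟨A + 1, A + 1 + X, by linarith, ?_⟩
  have L : (ts + T) ^ (-δ) * ∫ s in (-(ts / 2))..(ts / 2),
          (eKF M r T (wF r φ) ts s + B * eKF M r T (uF r φ) ts s) ≤
      2 * ∫ s in (A + ts)..(A + ts + X), (densF M r χ δ c T (wF r φ) (ts, s) + B * densF M r χ δ c T (uF r φ) (ts, s)) := by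
    have pw : ∀ s, (ts + T) ^ (-δ) * (eKF M r T (wF r φ) ts s + B * eKF M r T (uF r φ) ts s) ≤
        2 * (densF M r χ δ c T (wF r φ) (ts, s) + B * densF M r χ δ c T (uF r φ) (ts, s)) := by
      intro s
      have a1 := (cmp (wF r φ) ts s hts).1
      have a2 := mul_le_mul_of_nonneg_left (cmp (uF r φ) ts s hts).1 hB0.le
      linarith
    rw [← intervalIntegral.integral_const_mul, ← intervalIntegral.integral_const_mul]
    calc _ ≤ ∫ s in (-(ts / 2))..(ts / 2), 2 * (densF M r χ δ c T (wF r φ) (ts, s) + B * densF M r χ δ c T (uF r φ) (ts, s)) := by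
          apply intervalIntegral.integral_mono_on (by linarith)
          · apply Continuous.intervalIntegrable
            have := eKw ts
            have := eKu ts
            fun_prop
          · apply Continuous.intervalIntegrable
            have := cw ts hts
            have := cu ts hts
            fun_prop
          · exact fun s _ => pw s
      _ ≤ _ := by
          apply intervalIntegral.integral_mono_interval
          · linarith
          · linarith
          · linarith [abs_nonneg S₀]
          · refine Filter.Eventually.of_forall fun s => le_trans ?_ (pw s)
            have := eKF_nonneg hM hr T (wF r φ) ts s
            have := eKF_nonneg hM hr T (uF r φ) ts s
            have : 0 < ts + T := by linarith
            show (0:ℝ) ≤ _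
            positivity
          · apply Continuous.intervalIntegrable
            have := cw ts hts
            have := cu ts hts
            fun_prop
  have Rr : ∫ s in (A + 1)..(A + 1 + X), (densF M r χ δ c T (wF r φ) (1, s) + B * densF M r χ δ c T (uF r φ) (1, s))
      ≤ 3 / 2 * ∫ s in (A + 1)..(A + 1 + X), (eKF M r T (wF r φ) 1 s + B * eKF M r T (uF r φ) 1 s) := by
    rw [← intervalIntegral.integral_const_mul]
    apply intervalIntegral.integral_mono_on (by linarith)
    · apply Continuous.intervalIntegrable
      have := cw 1 le_rfl
      have := cu 1 le_rfl
      fun_prop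
    · apply Continuous.intervalIntegrable
      have := eKw 1
      have := eKu 1
      fun_prop
    · intro s _
      have a1 := (cmp (wF r φ) 1 s le_rfl).2
      have a2 := mul_le_mul_of_nonneg_left (cmp (uF r φ) 1 s le_rfl).2 hB0.le
      have p1 : (1 + T) ^ (-δ) ≤ 1 := Real.rpow_le_one_of_one_le_of_nonpos (by linarith) (by linarith)
      have n1 := eKF_nonneg hM hr T (wF r φ) 1 s
      have n2 := eKF_nonneg hM hr T (uF r φ) 1 s
      have := mul_le_mul_of_nonneg_right p1 (by positivity : 0 ≤ 3 / 2 * (eKF M r T (wF r φ) 1 s + B * eKF M r T (uF r φ) 1 s))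
      linarith
  linarith

end main
end

section
section fin
variable {M : ℝ} {r : ℝ → ℝ} {φ : ℝ → ℝ → ℝ}

/-- logarithmic derivative of the radius -/
def Gf (M : ℝ) (r : ℝ → ℝ) (s : ℝ) : ℝ := aM M * muS M r s * sg M r s ^ 2

lemma Gf_contDiff (hM : 0 < M) (hr : IsTortoise M r) : ContDiff ℝ (⊤ : ℕ∞) (Gf M r) := by
  have h1 := mu_contDiff hM hr
  have h2 := sg_contDiff hM hr
  unfold Gf; fun_prop

lemma Gf_mul (hM : 0 < M) (hr : IsTortoise M r) (s : ℝ) : Gf M r s * r s = sg M r s ^ 2 := by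
  have e := r_mul hM hr s
  unfold Gf; linear_combination sg M r s ^ 2 * e

lemma Gf_nonneg (hM : 0 < M) (hr : IsTortoise M r) (s : ℝ) : 0 ≤ Gf M r s := by
  have := mu_pos hM hr s
  have := aM_pos hM
  unfold Gf; positivity

lemma Gf_deriv (hM : 0 < M) (hr : IsTortoise M r) (s : ℝ) :
    HasDerivAt (Gf M r) (Vf M r s - Gf M r s ^ 2) s := by
  have h1 := hasDeriv_mu hM hr s
  have h2 := hasDeriv_sg hM hr s
  refine ((h1.const_mul (aM M)).mul (h2.fun_pow 2)).congr_deriv ?_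
  unfold Vf VC Gf
  push_cast
  ring

lemma Gf_sq_le (hM : 0 < M) (hr : IsTortoise M r) {s : ℝ} (hs : s ≤ 0) :
    Gf M r s ^ 2 ≤ 3 / 2 * Vf M r s ∧ Gf M r s ≤ 9 / 2 * M * Vf M r s := by
  have hr3 := r_le_neg hM hr hs
  have hrp := r_pos hM hr s
  have hm : 2 / 3 ≤ muS M r s := by
    unfold muS; rw [le_div_iff₀ hrp]; linarith
  have h0 := sg_pos hM hr s
  have h1 := sg_lt_one hM hr s
  have ha := aM_pos hM
  have haM : aM M * M = 1 / 2 := by unfold aM; field_simp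
  unfold Gf Vf VC
  generalize muS M r s = m at *
  generalize sg M r s = σ at *
  generalize aM M = a at *
  have hs2 : σ ^ 2 ≤ 1 := by nlinarith
  constructor
  · have : 0 ≤ a ^ 2 * m ^ 2 * σ ^ 2 * (3 / 2 * m - σ ^ 2) := mul_nonneg (by positivity) (by linarith)
    nlinarith
  · have e : 9 / 2 * M * (a ^ 2 * m ^ 3 * σ ^ 2) = a * m * σ ^ 2 * (9 / 4 * m ^ 2) := by
      linear_combination (9 / 2 * a * m ^ 3 * σ ^ 2) * haM
    rw [e]
    have : 0 ≤ a * m * σ ^ 2 := by positivity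
    exact le_mul_of_one_le_right this (by nlinarith)

lemma sG_sq (hM : 0 < M) (hr : IsTortoise M r) (s : ℝ) : (s * Gf M r s) ^ 2 ≤ 41 ∧
    (s * Vf M r s) ^ 2 ≤ 41 * Vf M r s := by
  have b := sg_b hM hr s
  have h0 := sg_pos hM hr s
  have h1 := sg_lt_one hM hr s
  have m0 := mu_pos hM hr s
  have m1 := mu_lt_one hM hr s
  have hV := Vf_nonneg hM hr s
  have e1 : (s * Gf M r s) ^ 2 = sg M r s ^ 3 * (sg M r s * (aM M * muS M r s * s) ^ 2) := by
    unfold Gf; ring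
  have e2 : (s * Vf M r s) ^ 2 = Vf M r s * ((muS M r s * sg M r s) * (sg M r s * (aM M * muS M r s * s) ^ 2)) := by
    unfold Vf VC; ring
  have hn : 0 ≤ sg M r s * (aM M * muS M r s * s) ^ 2 := by positivity
  constructor
  · rw [e1]
    have : sg M r s ^ 3 ≤ 1 := pow_le_one₀ h0.le h1.le
    nlinarith
  · rw [e2, mul_comm 41]
    apply mul_le_mul_of_nonneg_left _ hV
    have : muS M r s * sg M r s ≤ 1 := by nlinarith
    nlinarith

lemma sub_r_le (hM : 0 < M) (hr : IsTortoise M r) {s : ℝ} (hs : 0 ≤ s) : (s - r s) ^ 2 ≤ 48 * M * r s := by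
  set κ := 4 * √(3 * M) with hκ
  have h3M : 0 < √(3 * M) := Real.sqrt_pos.2 (by positivity)
  have hsq : √(3 * M) ^ 2 = 3 * M := Real.sq_sqrt (by positivity)
  have hd : ∀ x, HasDerivAt (fun x => x - r x - κ * √(r x))
      (1 - sg M r x ^ 2 - κ * (sg M r x ^ 2 / (2 * √(r x)))) x := fun x =>
    ((hasDerivAt_id x).sub (hasDeriv_r hM hr x)).sub
      (((hasDeriv_r hM hr x).sqrt (r_pos hM hr x).ne').const_mul κ)
  have hm : AntitoneOn (fun x => x - r x - κ * √(r x)) (Set.Ici 0) := by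
    apply antitoneOn_of_deriv_nonpos (convex_Ici 0)
    · exact fun x _ => (hd x).continuousAt.continuousWithinAt
    · exact fun x _ => (hd x).differentiableAt.differentiableWithinAt
    · intro x hx
      rw [interior_Ici] at hx
      rw [(hd x).deriv]
      have hrx := le_r hM hr (le_of_lt hx)
      have hx0 : (0:ℝ) < x := hx
      have hr3 : 3 * M ≤ r x := by linarith
      have hrp := r_pos hM hr x
      have hsr : √(3 * M) ≤ √(r x) := Real.sqrt_le_sqrt hr3
      have hsr2 : √(r x) ^ 2 = r x := Real.sq_sqrt hrp.le
      have hmu : muS M r x = 2 * M / √(r x) ^ 2 := by rw [hsr2]; rfl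
      have hσ := sg_sq hM hr x
      have hmu3 : muS M r x ≤ 2 / 3 := by
        unfold muS; rw [div_le_iff₀ hrp]; linarith
      have hpos : 0 < √(r x) := Real.sqrt_pos.2 hrp
      have : κ * (1 / 3 / (2 * √(r x))) ≤ κ * (sg M r x ^ 2 / (2 * √(r x))) := by
        gcongr; linarith
      have h2 : 1 - sg M r x ^ 2 = muS M r x := by linarith
      rw [h2, hmu]
      have : 2 * M / √(r x) ^ 2 ≤ κ * (1 / 3 / (2 * √(r x))) := by
        rw [hκ, div_le_iff₀ (by positivity)]
        generalize √(3 * M) = q at *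
        generalize √(r x) = y at *
        have : 4 * q * (1 / 3 / (2 * y)) * y ^ 2 = 2 / 3 * (q * y) := by field_simp; ring
        rw [this]
        nlinarith
      linarith
  have h0 := hm (Set.self_mem_Ici) (Set.mem_Ici.2 hs) hs
  simp only at h0
  rw [hr.2.2] at h0
  have hrx := le_r hM hr hs
  have hr3 : 3 * M ≤ r s := by linarith
  have hle := r_le hM hr hs
  have hsr : √(3 * M) ≤ √(r s) := Real.sqrt_le_sqrt hr3
  have hsr2 : √(r s) ^ 2 = r s := Real.sq_sqrt (by linarith)
  have habs : |s - r s| ≤ κ * √(r s) := by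
    rw [abs_le]
    constructor
    · have : √(3 * M) * √(3 * M) ≤ κ * √(r s) := by rw [hκ]; nlinarith
      nlinarith
    · have : 0 ≤ κ * √(3 * M) := by positivity
      linarith
  calc (s - r s) ^ 2 = |s - r s| ^ 2 := (sq_abs _).symm
    _ ≤ (κ * √(r s)) ^ 2 := by gcongr
    _ = _ := by rw [mul_pow, hsr2, hκ, mul_pow, hsq]; ring

lemma one_sub_sG (hM : 0 < M) (hr : IsTortoise M r) (s : ℝ) :
    (1 - s * Gf M r s) ^ 2 ≤ 126 * muS M r s := by
  have hrp := r_pos hM hr s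
  rcases le_total s 0 with hs | hs
  · have hm : 2 / 3 ≤ muS M r s := by
      unfold muS; rw [le_div_iff₀ hrp]; linarith [r_le_neg hM hr hs]
    have := (sG_sq hM hr s).1
    nlinarith [sq_nonneg (1 + s * Gf M r s)]
  · have h1 := sub_r_le hM hr hs
    have h2 := le_r hM hr hs
    have hG := Gf_mul hM hr s
    have hmr : muS M r s * r s = 2 * M := by unfold muS; field_simp
    have hσ := sg_sq hM hr s
    have hm0 := mu_pos hM hr s
    have e : (1 - s * Gf M r s) * r s = (r s - s) + s * muS M r s := by
      rw [hσ] at hG; linear_combination (-s) * hG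
    have h3 : s * muS M r s ≤ 6 * M := by nlinarith
    have h30 : 0 ≤ s * muS M r s := by positivity
    have h4 : (s * muS M r s) ^ 2 ≤ 12 * M * r s := by
      calc _ ≤ (6 * M) ^ 2 := by gcongr
        _ ≤ _ := by nlinarith
    have h5 : ((1 - s * Gf M r s) * r s) ^ 2 ≤ 120 * M * r s := by
      rw [e]; nlinarith [sq_nonneg ((r s - s) - s * muS M r s)]
    have h6 : (1 - s * Gf M r s) ^ 2 * r s ^ 2 ≤ 60 * muS M r s * r s ^ 2 := by
      calc _ = ((1 - s * Gf M r s) * r s) ^ 2 := by ring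
        _ ≤ _ := h5
        _ = 60 * (muS M r s * r s) * r s := by rw [hmr]; ring
        _ = _ := by ring
    have := le_of_mul_le_mul_right h6 (by positivity)
    linarith

lemma sGd_sq (hM : 0 < M) (hr : IsTortoise M r) (s : ℝ) :
    (Gf M r s + s * (Vf M r s - Gf M r s ^ 2)) ^ 2 ≤ 334 * Vf M r s := by
  have h1 := one_sub_sG hM hr s
  have h2 := (sG_sq hM hr s).2
  have h0 := sg_pos hM hr s
  have hl := sg_lt_one hM hr s
  have hm0 := mu_pos hM hr s
  have hV := Vf_nonneg hM hr s
  have h3 : (Gf M r s * (1 - s * Gf M r s)) ^ 2 ≤ 126 * Vf M r s := by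
    have hs2 : sg M r s ^ 2 ≤ 1 := by nlinarith
    calc _ = Gf M r s ^ 2 * (1 - s * Gf M r s) ^ 2 := by ring
      _ ≤ Gf M r s ^ 2 * (126 * muS M r s) := by gcongr
      _ = 126 * Vf M r s * sg M r s ^ 2 := by unfold Gf Vf VC; ring
      _ ≤ 126 * Vf M r s * 1 := by gcongr
      _ = _ := by ring
  nlinarith [sq_nonneg (Gf M r s * (1 - s * Gf M r s) - s * Vf M r s)]

lemma w_split (hM : 0 < M) (hr : IsTortoise M r) (hφ : ContDiff ℝ (⊤ : ℕ∞) (Function.uncurry φ)) (t s : ℝ) :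
    wF r φ t s = uF r (Svf φ) t s + s * Gf M r s * uF r φ t s := by
  have hG := Gf_mul hM hr s
  unfold wF Svf
  rw [uF_t hφ, uF_s hM hr hφ]
  unfold uF
  linear_combination (-(s * φ t s)) * hG

lemma w_split_t (hM : 0 < M) (hr : IsTortoise M r) (hφ : ContDiff ℝ (⊤ : ℕ∞) (Function.uncurry φ)) (t s : ℝ) :
    pd_t (wF r φ) t s = pd_t (uF r (Svf φ)) t s + s * Gf M r s * pd_t (uF r φ) t s := by
  have e : (fun t' => wF r φ t' s) = fun t' => uF r (Svf φ) t' s + s * Gf M r s * uF r φ t' s :=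
    funext fun t' => w_split hM hr hφ t' s
  unfold pd_t at *
  rw [e]
  exact ((hasDeriv_t (uF_smooth hM hr (Svf_smooth hφ)) t s).add
    ((hasDeriv_t (uF_smooth hM hr hφ) t s).const_mul _)).deriv

lemma w_split_s (hM : 0 < M) (hr : IsTortoise M r) (hφ : ContDiff ℝ (⊤ : ℕ∞) (Function.uncurry φ)) (t s : ℝ) :
    pd_s (wF r φ) t s = pd_s (uF r (Svf φ)) t s + (Gf M r s + s * (Vf M r s - Gf M r s ^ 2)) * uF r φ t s
      + s * Gf M r s * pd_s (uF r φ) t s := by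
  have e : (fun s' => wF r φ t s') = fun s' => uF r (Svf φ) t s' + s' * Gf M r s' * uF r φ t s' :=
    funext fun s' => w_split hM hr hφ t s'
  unfold pd_s at *
  rw [e]
  have := ((hasDeriv_s (uF_smooth hM hr (Svf_smooth hφ)) t s).add
    (((hasDerivAt_id s).mul (Gf_deriv hM hr s)).mul (hasDeriv_s (uF_smooth hM hr hφ) t s))).deriv
  refine Eq.trans this ?_
  simp only [id, one_mul, pd_s, Pi.mul_apply]
  ring

/-- energy density -/
def eF (M : ℝ) (r : ℝ → ℝ) (v : ℝ → ℝ → ℝ) (t s : ℝ) : ℝ :=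
  pd_t v t s ^ 2 + pd_s v t s ^ 2 + Vf M r s * v t s ^ 2

lemma eF_nonneg (hM : 0 < M) (hr : IsTortoise M r) (v : ℝ → ℝ → ℝ) (t s : ℝ) : 0 ≤ eF M r v t s := by
  have := Vf_nonneg hM hr s
  unfold eF; positivity

lemma eF_cont (hM : 0 < M) (hr : IsTortoise M r) {v : ℝ → ℝ → ℝ}
    (hv : ContDiff ℝ (⊤ : ℕ∞) (Function.uncurry v)) (t : ℝ) : Continuous (eF M r v t) := by
  have h1 := slice_cont hv t
  have h2 := slice_cont (pd_t_smooth hv) t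
  have h3 := slice_cont (pd_s_smooth hv) t
  have h4 := (Vf_contDiff hM hr).continuous
  unfold eF
  fun_prop

lemma eF_le (hM : 0 < M) (hr : IsTortoise M r) (hφ : ContDiff ℝ (⊤ : ℕ∞) (Function.uncurry φ)) (t s : ℝ) :
    eF M r (uF r (Svf φ)) t s ≤ 3 * eF M r (wF r φ) t s + 1100 * eF M r (uF r φ) t s := by
  have e0 := w_split hM hr hφ t s
  have e1 := w_split_t hM hr hφ t s
  have e2 := w_split_s hM hr hφ t s
  have b1 := (sG_sq hM hr s).1
  have b2 := sGd_sq hM hr s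
  have hV := Vf_nonneg hM hr s
  unfold eF
  generalize s * Gf M r s = b at *
  generalize Gf M r s + s * (Vf M r s - Gf M r s ^ 2) = b' at *
  generalize Vf M r s = V at *
  generalize uF r φ t s = u at *
  generalize pd_t (uF r φ) t s = ut at *
  generalize pd_s (uF r φ) t s = us at *
  generalize uF r (Svf φ) t s = v at *
  generalize pd_t (uF r (Svf φ)) t s = vt at *
  generalize pd_s (uF r (Svf φ)) t s = vs at *
  generalize wF r φ t s = w at *
  generalize pd_t (wF r φ) t s = wt at *
  generalize pd_s (wF r φ) t s = ws at *
  obtain rfl : v = w - b * u := by linarith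
  obtain rfl : vt = wt - b * ut := by linarith
  obtain rfl : vs = ws - b' * u - b * us := by linarith
  have c1 : (b * ut) ^ 2 ≤ 41 * ut ^ 2 := by rw [mul_pow]; gcongr
  have c2 : (b * us) ^ 2 ≤ 41 * us ^ 2 := by rw [mul_pow]; gcongr
  have c3 : (b * u) ^ 2 ≤ 41 * u ^ 2 := by rw [mul_pow]; gcongr
  have c4 : (b' * u) ^ 2 ≤ 334 * V * u ^ 2 := by rw [mul_pow]; gcongr
  have d1 : (wt - b * ut) ^ 2 ≤ 2 * wt ^ 2 + 82 * ut ^ 2 := by nlinarith [sq_nonneg (wt + b * ut)]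
  have d2 : (ws - b' * u - b * us) ^ 2 ≤ 3 * ws ^ 2 + 3 * (334 * V * u ^ 2) + 123 * us ^ 2 := by
    nlinarith [sq_nonneg (ws + b' * u), sq_nonneg (ws + b * us), sq_nonneg (b' * u - b * us)]
  have d3 : (w - b * u) ^ 2 ≤ 2 * w ^ 2 + 82 * u ^ 2 := by nlinarith [sq_nonneg (w + b * u)]
  have d4 := mul_le_mul_of_nonneg_left d3 hV
  have p1 : 0 ≤ V * w ^ 2 := by positivity
  have p2 : 0 ≤ V * u ^ 2 := by positivity
  nlinarith [sq_nonneg wt, sq_nonneg ut, sq_nonneg us, sq_nonneg ws]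

end fin
end

section
section fin
variable {M : ℝ} {r : ℝ → ℝ} {φ : ℝ → ℝ → ℝ}

lemma local_cmp (hM : 0 < M) (hr : IsTortoise M r) {ξ : ℝ → ℝ → ℝ}
    (hξ : ContDiff ℝ (⊤ : ℕ∞) (Function.uncurry ξ)) {t : ℝ} (ht : 2 ≤ t) :
    ∫ s in (-(t / 2))..(t / 2), (pd_t ξ t s ^ 2 + pd_s ξ t s ^ 2) * r s ^ 2 ≤
      (5 * M + 5) * ∫ s in (-(t / 2))..(t / 2), eF M r (uF r ξ) t s := by
  set v := uF r ξ with hv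
  have hvs : ContDiff ℝ (⊤ : ℕ∞) (Function.uncurry v) := uF_smooth hM hr hξ
  have hGc := (Gf_contDiff hM hr).continuous
  have hVc := (Vf_contDiff hM hr).continuous
  have c0 := slice_cont hvs t
  have c1 := slice_cont (pd_t_smooth hvs) t
  have c2 := slice_cont (pd_s_smooth hvs) t
  have d1 := slice_cont (pd_t_smooth hξ) t
  have d2 := slice_cont (pd_s_smooth hξ) t
  have ce := eF_cont hM hr hvs t
  have rc := (r_contDiff hM hr).continuous
  -- integrand
  have eI : ∀ s, (pd_t ξ t s ^ 2 + pd_s ξ t s ^ 2) * r s ^ 2 =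
      pd_t v t s ^ 2 + (pd_s v t s - Gf M r s * v t s) ^ 2 := by
    intro s
    rw [hv, uF_t hξ, uF_s hM hr hξ]
    have hG := Gf_mul hM hr s
    have : sg M r s ^ 2 * ξ t s + r s * pd_s ξ t s - Gf M r s * uF r ξ t s = r s * pd_s ξ t s := by
      unfold uF; linear_combination (-(ξ t s)) * hG
    rw [this]; ring
  set Z' : ℝ → ℝ := fun s => (Vf M r s - Gf M r s ^ 2) * v t s ^ 2 + Gf M r s * (2 * v t s * pd_s v t s) with hZ'
  have cZ : Continuous Z' := by rw [hZ']; fun_prop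
  have hZ : ∀ s, HasDerivAt (fun s => Gf M r s * v t s ^ 2) (Z' s) s := fun s => by
    refine ((Gf_deriv hM hr s).mul ((hasDeriv_s hvs t s).fun_pow 2)).congr_deriv ?_
    rw [hZ']; push_cast; ring
  have r1 : ∫ s in (0:ℝ)..(t / 2), (pd_t ξ t s ^ 2 + pd_s ξ t s ^ 2) * r s ^ 2 ≤
      (∫ s in (0:ℝ)..(t / 2), eF M r v t s) + Gf M r 0 * v t 0 ^ 2 := by
    have ftc := intervalIntegral.integral_eq_sub_of_hasDerivAt (a := 0) (b := t / 2) (fun s _ => hZ s)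
      (cZ.intervalIntegrable _ _)
    have : ∫ s in (0:ℝ)..(t / 2), (pd_t ξ t s ^ 2 + pd_s ξ t s ^ 2) * r s ^ 2 =
      ∫ s in (0:ℝ)..(t / 2), (eF M r v t s - Z' s) := by
      apply intervalIntegral.integral_congr
      intro s _
      simp only [eI, hZ', eF]; ring
    rw [this, intervalIntegral.integral_sub (ce.intervalIntegrable _ _) (cZ.intervalIntegrable _ _), ftc]
    have := mul_nonneg (Gf_nonneg hM hr (t / 2)) (sq_nonneg (v t (t / 2)))
    linarith
  have r2 : Gf M r 0 * v t 0 ^ 2 ≤ ∫ s in (-1:ℝ)..0, (5 * M + 1) * eF M r v t s := by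
    have hd : ∀ s, HasDerivAt (fun s => (1 + s) * (Gf M r s * v t s ^ 2)) (Gf M r s * v t s ^ 2 + (1 + s) * Z' s) s :=
      fun s => (((hasDerivAt_id s).const_add 1).mul (hZ s)).congr_deriv (by simp)
    have ftc := intervalIntegral.integral_eq_sub_of_hasDerivAt (a := -1) (b := 0) (fun s _ => hd s)
      (Continuous.intervalIntegrable (by fun_prop) _ _)
    have : Gf M r 0 * v t 0 ^ 2 = ∫ s in (-1:ℝ)..0, (Gf M r s * v t s ^ 2 + (1 + s) * Z' s) := by
      rw [ftc]; ring
    rw [this]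
    apply intervalIntegral.integral_mono_on (by norm_num)
    · exact Continuous.intervalIntegrable (by fun_prop) _ _
    · exact Continuous.intervalIntegrable (by fun_prop) _ _
    · intro s hs
      have hV := Vf_nonneg hM hr s
      have hG := (Gf_sq_le hM hr hs.2).2
      have g1 := mul_le_mul_of_nonneg_right hG (sq_nonneg (v t s))
      simp only [hZ', eF]
      have h1 : 0 ≤ 1 + s := by linarith [hs.1]
      have h2 : 1 + s ≤ 1 := by linarith [hs.2]
      have z1 : (Vf M r s - Gf M r s ^ 2) * v t s ^ 2 + Gf M r s * (2 * v t s * pd_s v t s)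
          ≤ Vf M r s * v t s ^ 2 + pd_s v t s ^ 2 := by
        nlinarith [sq_nonneg (Gf M r s * v t s - pd_s v t s)]
      have z2 := mul_le_mul_of_nonneg_left z1 h1
      have z3 := mul_le_mul_of_nonneg_right h2 (by positivity : 0 ≤ Vf M r s * v t s ^ 2 + pd_s v t s ^ 2)
      have p1 : 0 ≤ M * (Vf M r s * v t s ^ 2) := by positivity
      have p2 : 0 ≤ M * (pd_t v t s ^ 2 + pd_s v t s ^ 2) := by positivity
      nlinarith [sq_nonneg (pd_t v t s)]
  have r3 : ∫ s in (-1:ℝ)..0, (5 * M + 1) * eF M r v t s ≤ ∫ s in (-(t / 2))..0, (5 * M + 1) * eF M r v t s := by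
    apply intervalIntegral.integral_mono_interval
    · linarith
    · norm_num
    · exact le_rfl
    · refine Filter.Eventually.of_forall fun s => ?_
      have := eF_nonneg hM hr v t s
      show (0:ℝ) ≤ _
      positivity
    · exact Continuous.intervalIntegrable (by fun_prop) _ _
  have r4 : ∫ s in (-(t / 2))..0, (pd_t ξ t s ^ 2 + pd_s ξ t s ^ 2) * r s ^ 2 ≤
      ∫ s in (-(t / 2))..0, 3 * eF M r v t s := by
    apply intervalIntegral.integral_mono_on (by linarith)
    · exact Continuous.intervalIntegrable (by fun_prop) _ _
    · exact Continuous.intervalIntegrable (by fun_prop) _ _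
    · intro s hs
      have hG := (Gf_sq_le hM hr hs.2).1
      have g1 := mul_le_mul_of_nonneg_right hG (sq_nonneg (v t s))
      rw [eI]; unfold eF
      nlinarith [sq_nonneg (pd_t v t s), sq_nonneg (pd_s v t s + Gf M r s * v t s), sq_nonneg (pd_s v t s)]
  have ii : ∀ a b, IntervalIntegrable (fun s => (pd_t ξ t s ^ 2 + pd_s ξ t s ^ 2) * r s ^ 2) volume a b :=
    fun a b => Continuous.intervalIntegrable (by fun_prop) _ _
  have ie : ∀ a b, IntervalIntegrable (eF M r v t) volume a b := fun a b => ce.intervalIntegrable _ _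
  rw [← intervalIntegral.integral_add_adjacent_intervals (ii (-(t / 2)) 0) (ii 0 (t / 2)),
    ← intervalIntegral.integral_add_adjacent_intervals (ie (-(t / 2)) 0) (ie 0 (t / 2))]
  rw [intervalIntegral.integral_const_mul (r := 5 * M + 1) (a := -(t / 2))] at r3
  rw [intervalIntegral.integral_const_mul] at r4
  have n1 : 0 ≤ ∫ s in (-(t / 2))..0, eF M r v t s :=
    intervalIntegral.integral_nonneg (by linarith) fun s _ => eF_nonneg hM hr v t s
  have n2 : 0 ≤ ∫ s in (0:ℝ)..(t / 2), eF M r v t s :=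
    intervalIntegral.integral_nonneg (by linarith) fun s _ => eF_nonneg hM hr v t s
  have r23 := r2.trans r3
  nlinarith [mul_nonneg hM.le n2, mul_nonneg hM.le n1]

lemma eF_le_eKF (hM : 0 < M) (hr : IsTortoise M r) {T t s : ℝ} (hT : 0 ≤ T) (ht : 0 < t)
    (hs : |s| ≤ t / 2) (v : ℝ → ℝ → ℝ) : 
    (t + T) ^ 2 / 8 * eF M r v t s ≤ eKF M r T v t s :=
  eKd_ge (Vf_nonneg hM hr s) (by linarith) (by linarith)

lemma E0I_nonneg (hM : 0 < M) (hr : IsTortoise M r) (ξ : ℝ → ℝ → ℝ) (s : ℝ) :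
    0 ≤ E0Integrand M r ξ s := by
  have : 0 < 1 - muS M r s := by linarith [mu_lt_one hM hr s]
  unfold E0Integrand; positivity

set_option maxHeartbeats 1000000 in
lemma init_alg {k R V m T s x p q i : ℝ} (hrp : 0 < R) (hm1 : m < 1) (hVr : V * R ^ 2 = m * k)
    (hk2 : 0 < k) (hk1 : k ≤ 1) (hinv : 1 ≤ i) (hT : 0 ≤ T) :
    ((1 + T + s) ^ 2 * (R * p + (k * x + R * q)) ^ 2 + (1 + T - s) ^ 2 * (R * p - (k * x + R * q)) ^ 2) / 4 +
      ((1 + T) ^ 2 + s ^ 2) / 2 * V * (R * x) ^ 2 ≤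
    (4 + T ^ 2 + 2 * (1 + T) ^ 2) * ((i * (p - q) ^ 2 + (p + q) ^ 2 + ((1 - s) / 2) ^ 2 * (p - q) ^ 2 + ((1 + s) / 2) ^ 2 * (p + q) ^ 2 +
      k * ((1 + s ^ 2) / R ^ 2) * x ^ 2) * R ^ 2) := by
  have ex : k * ((1 + s ^ 2) / R ^ 2) * x ^ 2 * R ^ 2 = k * (1 + s ^ 2) * x ^ 2 := by field_simp
  -- pieces
  have t1 : ∀ y : ℝ, (y + k * x) ^ 2 ≤ 2 * y ^ 2 + 2 * (k * x ^ 2) := by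
    intro y
    have : k ^ 2 * x ^ 2 ≤ k * x ^ 2 := by
      have : k ^ 2 ≤ k := by nlinarith
      gcongr
    nlinarith [sq_nonneg (y - k * x)]
  have t2 : ∀ y : ℝ, (y - k * x) ^ 2 ≤ 2 * y ^ 2 + 2 * (k * x ^ 2) := by
    intro y
    have : k ^ 2 * x ^ 2 ≤ k * x ^ 2 := by
      have : k ^ 2 ≤ k := by nlinarith
      gcongr
    nlinarith [sq_nonneg (y + k * x)]
  have a1 : (1 + T + s) ^ 2 ≤ (8 + 2 * T ^ 2) * (1 + ((1 + s) / 2) ^ 2) := by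
    nlinarith [sq_nonneg (1 + s - T), mul_nonneg (sq_nonneg T) (sq_nonneg ((1 + s) / 2))]
  have a2 : (1 + T - s) ^ 2 ≤ (8 + 2 * T ^ 2) * (1 + ((1 - s) / 2) ^ 2) := by
    nlinarith [sq_nonneg (1 - s - T), mul_nonneg (sq_nonneg T) (sq_nonneg ((1 - s) / 2))]
  have a3 : (1 + T) ^ 2 + s ^ 2 ≤ (1 + T) ^ 2 * (1 + s ^ 2) := by
    have : 1 ≤ (1 + T) ^ 2 := by nlinarith
    nlinarith [sq_nonneg s]
  have b1 : (1 + T + s) ^ 2 * (R * p + (k * x + R * q)) ^ 2 ≤ 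
     (1 + T + s) ^ 2 * (2 * (R * (p + q)) ^ 2 + 2 * (k * x ^ 2)) := by
    gcongr
    have := t1 (R * (p + q))
    calc _ = (R * (p + q) + k * x) ^ 2 := by ring
      _ ≤ _ := this
  have b2 : (1 + T - s) ^ 2 * (R * p - (k * x + R * q)) ^ 2 ≤ 
     (1 + T - s) ^ 2 * (2 * (R * (p - q)) ^ 2 + 2 * (k * x ^ 2)) := by
    gcongr
    have := t2 (R * (p - q))
    calc _ = (R * (p - q) - k * x) ^ 2 := by ring
      _ ≤ _ := this
  have b3 : (1 + T + s) ^ 2 * (R * (p + q)) ^ 2 ≤ (8 + 2 * T ^ 2) * (1 + ((1 + s) / 2) ^ 2) * (R * (p + q)) ^ 2 := by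
    gcongr
  have b4 : (1 + T - s) ^ 2 * (R * (p - q)) ^ 2 ≤ (8 + 2 * T ^ 2) * (i + ((1 - s) / 2) ^ 2) * (R * (p - q)) ^ 2 := by
    gcongr
    refine a2.trans ?_
    gcongr
  have b5 : ((1 + T) ^ 2 + s ^ 2) * (k * x ^ 2) ≤ (1 + T) ^ 2 * (1 + s ^ 2) * (k * x ^ 2) := by gcongr
  have b6 : ((1 + T) ^ 2 + s ^ 2) / 2 * V * (R * x) ^ 2 ≤ ((1 + T) ^ 2 + s ^ 2) / 2 * (k * x ^ 2) := by
    have : V * R ^ 2 ≤ k := by rw [hVr]; exact mul_le_of_le_one_left hk2.le hm1.le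
    calc _ = ((1 + T) ^ 2 + s ^ 2) / 2 * (V * R ^ 2 * x ^ 2) := by ring
      _ ≤ _ := by gcongr
  have i0 : 0 < i := by positivity
  have q1 : 0 ≤ (1 + ((1 + s) / 2) ^ 2) * (R * (p + q)) ^ 2 + (i + ((1 - s) / 2) ^ 2) * (R * (p - q)) ^ 2 := by positivity
  have q2 : 0 ≤ k * (1 + s ^ 2) * x ^ 2 := by positivity
  have rhs : (i * (p - q) ^ 2 + (p + q) ^ 2 + ((1 - s) / 2) ^ 2 * (p - q) ^ 2 + ((1 + s) / 2) ^ 2 * (p + q) ^ 2 +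
      k * ((1 + s ^ 2) / R ^ 2) * x ^ 2) * R ^ 2 = ((1 + ((1 + s) / 2) ^ 2) * (R * (p + q)) ^ 2 + (i + ((1 - s) / 2) ^ 2) * (R * (p - q)) ^ 2)
      + k * (1 + s ^ 2) * x ^ 2 := by rw [← ex]; ring
  rw [rhs]
  have q3 := mul_nonneg (sq_nonneg (1 + T)) q1
  have q4 := mul_nonneg (sq_nonneg (1 + T)) q2
  have q5 := mul_nonneg (sq_nonneg T) q2
  have q6 := mul_nonneg (sq_nonneg T) q1
  have ey : k * (1 + s ^ 2) * x ^ 2 = (1 + s ^ 2) * (k * x ^ 2) := by ring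
  rw [ey] at q2 q4 q5 ⊢
  clear rhs ex t1 t2 ey
  generalize (R * (p + q)) ^ 2 = P at *
  generalize (R * (p - q)) ^ 2 = P' at *
  generalize k * x ^ 2 = y at *
  linarith

lemma init_one (hM : 0 < M) (hr : IsTortoise M r) {ξ : ℝ → ℝ → ℝ}
    (hξ : ContDiff ℝ (⊤ : ℕ∞) (Function.uncurry ξ)) {T : ℝ} (hT : 0 ≤ T) (s : ℝ) :
    eKF M r T (uF r ξ) 1 s ≤ (4 + T ^ 2 + 2 * (1 + T) ^ 2) * E0Integrand M r ξ s := by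
  have hrp := r_pos hM hr s
  have hm0 := mu_pos hM hr s
  have hσ := sg_sq hM hr s
  have hm1 := mu_lt_one hM hr s
  have hG := Gf_mul hM hr s
  have hVr : Vf M r s * r s ^ 2 = muS M r s * sg M r s ^ 2 := by
    have e := r_mul hM hr s
    unfold Vf VC
    linear_combination (muS M r s * sg M r s ^ 2) * (aM M * muS M r s * r s + 1) * e
  unfold eKF eKd E0Integrand
  rw [uF_t hξ, uF_s hM hr hξ, ← hσ, ← hG]
  have hu : uF r ξ 1 s = r s * ξ 1 s := rfl
  rw [hu]
  have hk2 : 0 < sg M r s ^ 2 := by rw [hσ]; linarith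
  have hk1 : sg M r s ^ 2 ≤ 1 := by rw [hσ]; linarith
  rw [← hG] at hk2 hk1 hVr
  have hinv : 1 ≤ (Gf M r s * r s)⁻¹ := (one_le_inv₀ hk2).2 hk1
  have key := init_alg (s := s) (x := ξ 1 s) (p := pd_t ξ 1 s) (q := pd_s ξ 1 s) (i := (Gf M r s * r s)⁻¹)
    hrp hm1 hVr hk2 hk1 hinv hT
  exact key

lemma eKd_add {τ s V a b c a' b' c' : ℝ} (hV : 0 ≤ V) : 
    eKd τ s V (a + a') (b + b') (c + c') ≤ 2 * eKd τ s V a b c + 2 * eKd τ s V a' b' c' := by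
  have : 2 * eKd τ s V a b c + 2 * eKd τ s V a' b' c' - eKd τ s V (a + a') (b + b') (c + c') =
    eKd τ s V (a - a') (b - b') (c - c') := by unfold eKd; ring
  have := eKd_nonneg (τ := τ) (s := s) (v := a - a') (vt := b - b') (vs := c - c') hV
  linarith

lemma init_w (hM : 0 < M) (hr : IsTortoise M r) (hφ : ContDiff ℝ (⊤ : ℕ∞) (Function.uncurry φ)) (T t s : ℝ) :
    eKF M r T (wF r φ) t s ≤ 2 * eKF M r T (uF r (Svf φ)) t s + 1500 * eKF M r T (uF r φ) t s := by
  have hV := Vf_nonneg hM hr s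
  have b1 := (sG_sq hM hr s).1
  have b2 := sGd_sq hM hr s
  unfold eKF
  rw [w_split hM hr hφ, w_split_t hM hr hφ, w_split_s hM hr hφ]
  generalize s * Gf M r s = b at *
  generalize Gf M r s + s * (Vf M r s - Gf M r s ^ 2) = b' at *
  generalize Vf M r s = V at *
  generalize uF r φ t s = u at *
  generalize pd_t (uF r φ) t s = ut at *
  generalize pd_s (uF r φ) t s = us at *
  have h1 := eKd_add (τ := t + T) (s := s) (a := uF r (Svf φ) t s) (b := pd_t (uF r (Svf φ)) t s)
    (c := pd_s (uF r (Svf φ)) t s) (a' := b * u) (b' := b * ut) (c' := b' * u + b * us) hV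
  have h2 := eKd_add (τ := t + T) (s := s) (a := 0) (b := 0)
    (c := b' * u) (a' := b * u) (b' := b * ut) (c' := b * us) hV
  rw [zero_add, zero_add] at h2
  rw [← add_assoc] at h1
  have h3 : eKd (t + T) s V (b * u) (b * ut) (b * us) = b ^ 2 * eKd (t + T) s V u ut us := by
    unfold eKd; ring
  have he := eKd_nonneg (τ := t + T) (s := s) (v := u) (vt := ut) (vs := us) hV
  have h4 := mul_le_mul_of_nonneg_right b1 he
  have h5 : eKd (t + T) s V 0 0 (b' * u) ≤ 334 * eKd (t + T) s V u ut us := by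
    have e1 : eKd (t + T) s V 0 0 (b' * u) = ((t + T) ^ 2 + s ^ 2) / 2 * (b' ^ 2 * u ^ 2) := by
      unfold eKd; ring
    have e2 : ((t + T) ^ 2 + s ^ 2) / 2 * (V * u ^ 2) ≤ eKd (t + T) s V u ut us := by
      unfold eKd
      have : 0 ≤ ((t + T + s) ^ 2 * (ut + us) ^ 2 + (t + T - s) ^ 2 * (ut - us) ^ 2) / 4 := by positivity
      linarith
    rw [e1]
    calc _ ≤ ((t + T) ^ 2 + s ^ 2) / 2 * (334 * V * u ^ 2) := by gcongr
      _ = 334 * (((t + T) ^ 2 + s ^ 2) / 2 * (V * u ^ 2)) := by ring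
      _ ≤ _ := by gcongr
  linarith

end fin
end

section fin2
variable {M : ℝ} {r : ℝ → ℝ} {φ : ℝ → ℝ → ℝ}

lemma init_int (hM : 0 < M) (hr : IsTortoise M r) (hφ : ContDiff ℝ (⊤ : ℕ∞) (Function.uncurry φ))
    (hw : ContDiff ℝ (⊤ : ℕ∞) (Function.uncurry (wF r φ)))
    {T B : ℝ} (hT : 0 ≤ T) (hB : 0 < B) (hF : FinE1 M r φ) {a b : ℝ} (hab : a ≤ b) :
    ∫ s in a..b, (eKF M r T (wF r φ) 1 s + B * eKF M r T (uF r φ) 1 s) ≤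
      (1502 + B) * (4 + T ^ 2 + 2 * (1 + T) ^ 2) * E1 M r φ := by
  set C0 := 4 + T ^ 2 + 2 * (1 + T) ^ 2 with hC0
  have hC : 0 < C0 := by positivity
  obtain ⟨f1, f2, -⟩ := hF
  have hSφ := Svf_smooth hφ
  have cw := eKF_cont hM hr T hw 1
  have cu := eKF_cont hM hr T (uF_smooth hM hr hφ) 1
  have fi : Integrable (fun s => (1502 + B) * C0 * (E0Integrand M r (Svf φ) s + E0Integrand M r φ s)) :=
    (Integrable.add f1 f2).const_mul _
  have h1 : ∫ s in a..b, (eKF M r T (wF r φ) 1 s + B * eKF M r T (uF r φ) 1 s) ≤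
      ∫ s in a..b, (1502 + B) * C0 * (E0Integrand M r (Svf φ) s + E0Integrand M r φ s) := by
    apply intervalIntegral.integral_mono_on hab
    · exact Continuous.intervalIntegrable (by fun_prop) _ _
    · exact fi.intervalIntegrable
    · intro s _
      have i1 := init_w hM hr hφ T 1 s
      have i2 := init_one hM hr hSφ hT s
      have i3 := init_one hM hr hφ hT s
      rw [← hC0] at i2 i3
      have n1 := mul_nonneg hC.le (E0I_nonneg hM hr (Svf φ) s)
      have n2 := mul_nonneg hC.le (E0I_nonneg hM hr φ s)
      have n3 := mul_nonneg hB.le n1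
      have i4 := mul_le_mul_of_nonneg_left i3 hB.le
      linarith
  have h2 : ∫ s in a..b, (1502 + B) * C0 * (E0Integrand M r (Svf φ) s + E0Integrand M r φ s) ≤
      ∫ s, (1502 + B) * C0 * (E0Integrand M r (Svf φ) s + E0Integrand M r φ s) := by
    rw [intervalIntegral.integral_of_le hab]
    apply setIntegral_le_integral fi
    refine Filter.Eventually.of_forall fun s => ?_
    have n1 := E0I_nonneg hM hr (Svf φ) s
    have n2 := E0I_nonneg hM hr φ s
    show (0:ℝ) ≤ _
    positivity
  have h3 : ∫ s, (1502 + B) * C0 * (E0Integrand M r (Svf φ) s + E0Integrand M r φ s) =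
      (1502 + B) * C0 * (E0 M r (Svf φ) + E0 M r φ) := by
    rw [integral_const_mul, integral_add f1 f2]; rfl
  have h4 : 0 ≤ E0 M r (pd_t φ) := integral_nonneg fun s => E0I_nonneg hM hr _ s
  refine (h1.trans h2).trans ?_
  rw [h3]
  unfold E1
  exact mul_le_mul_of_nonneg_left (by linarith) (by positivity)

end fin2

/-- Theorem 10, part 3 (spherically symmetric case): decay of the local energy of
`ψ = Sφ` in the region `|r*| ≤ t/2`. -/
theorem local_energy_decay_of_Sphi
    (M : ℝ) (hM : 0 < M) (r : ℝ → ℝ) (hr : IsTortoise M r)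
    (δ : ℝ) (hδ0 : 0 < δ) (hδ1 : δ < 1) :
    ∃ C : ℝ, 0 < C ∧
      ∀ φ : ℝ → ℝ → ℝ, IsWaveSol r φ → FinE1 M r φ →
        ∀ tstar : ℝ, 2 ≤ tstar →
          (∫ s in (-(tstar / 2))..(tstar / 2),
              ((pd_t (Svf φ) tstar s) ^ 2 + (pd_s (Svf φ) tstar s) ^ 2) * (r s) ^ 2)
            ≤ C * tstar ^ (-(2 : ℝ) + δ) * E1 M r φ := by
  obtain ⟨T, B, hT, hB, hmain⟩ := energy_main hM hr hδ0 hδ1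
  set C0 := (1502 + B) * (4 + T ^ 2 + 2 * (1 + T) ^ 2) with hC0
  have hC : 0 < C0 := by positivity
  refine ⟨(5 * M + 5) * (8 * (3 + 1100 / B)) * (3 * C0), by positivity, ?_⟩
  intro φ hφ hF t ht
  have hs := hφ.1
  have hw : ContDiff ℝ (⊤ : ℕ∞) (Function.uncurry (wF r φ)) := Svf_smooth (uF_smooth hM hr hs)
  have hu := uF_smooth hM hr hs
  have hSu := uF_smooth hM hr (Svf_smooth hs)
  obtain ⟨a, b, hab, hE⟩ := hmain φ hφ t (by linarith)
  have hI := init_int hM hr hs hw hT hB hF hab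
  rw [← hC0] at hI
  have l1 := local_cmp hM hr (Svf_smooth hs) ht
  have hτ : 0 < t + T := by linarith
  set J := ∫ s in (-(t / 2))..(t / 2), (eKF M r T (wF r φ) t s + B * eKF M r T (uF r φ) t s) with hJ
  have l2 : ∫ s in (-(t / 2))..(t / 2), eF M r (uF r (Svf φ)) t s ≤
      (8 * (3 + 1100 / B)) * (((t + T) ^ 2)⁻¹ * J) := by
    rw [hJ, ← intervalIntegral.integral_const_mul, ← intervalIntegral.integral_const_mul]
    have cw := eKF_cont hM hr T hw t
    have cu := eKF_cont hM hr T hu t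
    have ce := eF_cont hM hr hSu t
    apply intervalIntegral.integral_mono_on (by linarith)
    · exact ce.intervalIntegrable _ _
    · exact Continuous.intervalIntegrable (by fun_prop) _ _
    · intro s hs'
      have h1 := eF_le hM hr hs t s
      have habs : |s| ≤ t / 2 := abs_le.2 ⟨hs'.1, hs'.2⟩
      have h2 := eF_le_eKF hM hr hT (by linarith) habs (wF r φ)
      have h3 := eF_le_eKF hM hr hT (by linarith) habs (uF r φ)
      have n1 := eKF_nonneg hM hr T (wF r φ) t s
      have n2 := eKF_nonneg hM hr T (uF r φ) t s
      generalize eKF M r T (wF r φ) t s = x at *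
      generalize eKF M r T (uF r φ) t s = y at *
      have hp : 0 < (t + T) ^ 2 := by positivity
      generalize (t + T) ^ 2 = p at *
      have h2' : eF M r (wF r φ) t s ≤ 8 * (p⁻¹ * x) := by
        have : 8 * p⁻¹ * (p / 8 * eF M r (wF r φ) t s) ≤ 8 * p⁻¹ * x := by gcongr
        have e : 8 * p⁻¹ * (p / 8 * eF M r (wF r φ) t s) = eF M r (wF r φ) t s := by field_simp
        linarith
      have h3' : eF M r (uF r φ) t s ≤ 8 * (p⁻¹ * y) := by
        have : 8 * p⁻¹ * (p / 8 * eF M r (uF r φ) t s) ≤ 8 * p⁻¹ * y := by gcongr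
        have e : 8 * p⁻¹ * (p / 8 * eF M r (uF r φ) t s) = eF M r (uF r φ) t s := by field_simp
        linarith
      have e : 8 * (3 + 1100 / B) * (p⁻¹ * (x + B * y)) = 24 * (p⁻¹ * x) + 8800 * (p⁻¹ * y)
          + 24 * B * (p⁻¹ * y) + 8800 / B * (p⁻¹ * x) := by field_simp; ring
      rw [e]
      have m1 : 0 ≤ 24 * B * (p⁻¹ * y) := by positivity
      have m2 : 0 ≤ 8800 / B * (p⁻¹ * x) := by positivity
      linarith
  have l3 : J ≤ (t + T) ^ δ * (3 * (C0 * E1 M r φ)) := by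
    have h := mul_le_mul_of_nonneg_left (hE.trans (mul_le_mul_of_nonneg_left hI (by norm_num : (0:ℝ) ≤ 3)))
      (rpow_nonneg hτ.le δ)
    rw [← mul_assoc, ← rpow_add hτ, add_neg_cancel, rpow_zero, one_mul] at h
    exact h
  have hE1 : 0 ≤ E1 M r φ := by
    unfold E1
    have : ∀ ξ, 0 ≤ E0 M r ξ := fun ξ => integral_nonneg fun s => E0I_nonneg hM hr ξ s
    exact add_nonneg (add_nonneg (this _) (this _)) (this _)
  have l4 : ((t + T) ^ 2)⁻¹ * (t + T) ^ δ ≤ t ^ (-(2 : ℝ) + δ) := by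
    have e : ((t + T) ^ 2)⁻¹ = (t + T) ^ (-(2:ℝ)) := by
      rw [rpow_neg hτ.le]; norm_num
    rw [e, ← rpow_add hτ]
    exact rpow_le_rpow_of_nonpos (by linarith) (by linarith) (by linarith)
  calc _ ≤ (5 * M + 5) * ((8 * (3 + 1100 / B)) * (((t + T) ^ 2)⁻¹ * J)) :=
        l1.trans (mul_le_mul_of_nonneg_left l2 (by positivity))
    _ ≤ (5 * M + 5) * ((8 * (3 + 1100 / B)) * (((t + T) ^ 2)⁻¹ * ((t + T) ^ δ * (3 * (C0 * E1 M r φ))))) := by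
        gcongr
    _ = (5 * M + 5) * ((8 * (3 + 1100 / B)) * ((((t + T) ^ 2)⁻¹ * (t + T) ^ δ) * (3 * (C0 * E1 M r φ)))) := by
        ring
    _ ≤ (5 * M + 5) * ((8 * (3 + 1100 / B)) * (t ^ (-(2 : ℝ) + δ) * (3 * (C0 * E1 M r φ)))) := by
        gcongr
    _ = _ := by ring
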